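/- arXiv:1601.02812 — 2 statements merged into one kernel-verified Lean document; each statement's English description precedes it below -/
import Mathlib

section
/- Monotonicity of profile components, subcritical case: Assume a² ≥ 0, b², c² > 0 with b⁴ < 3a²c², let k ∈ ℤ \ {0} and R ∈ (0,∞]. Let (u,v) be any profile solution on (0,R) such that u(r) > 0 and v(r) < 0 for all r ∈ (0,R). Then u'(r) > 0 and v'(r) > 0 for all r ∈ (0,R). -/
open Real MeasureTheory Filter Set Topology
open scoped ENNReal

noncomputable section

/-- `s₊ = (b² + √(b⁴ + 24 a² c²)) / (4c²)`, where `a2 = a²`, `b2 = b²`, `c2 = c²`. -/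
def sPlus (a2 b2 c2 : ℝ) : ℝ := (b2 + Real.sqrt (b2 ^ 2 + 24 * a2 * c2)) / (4 * c2)

/-- `h(p,q) = p(−a² + (2b²/√6)q + c²(p² + q²))`. -/
def hfun (a2 b2 c2 p q : ℝ) : ℝ :=
  p * (-a2 + 2 * b2 / Real.sqrt 6 * q + c2 * (p ^ 2 + q ^ 2))

/-- `g(p,q) = q(−a² − (b²/√6)q + c²(p² + q²)) + (b²/√6)p²`. -/
def gfun (a2 b2 c2 p q : ℝ) : ℝ :=
  q * (-a2 - b2 / Real.sqrt 6 * q + c2 * (p ^ 2 + q ^ 2)) + b2 / Real.sqrt 6 * p ^ 2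

/-- The interval `(0, R)` for `R ∈ (0,∞]`, as a subset of `ℝ`. -/
def Iset (R : ℝ≥0∞) : Set ℝ := {r : ℝ | 0 < r ∧ ENNReal.ofReal r < R}

/-- The filter of left-approach to the right endpoint `R`; `atTop` when `R = ∞`. -/
def endFilter (R : ℝ≥0∞) : Filter ℝ :=
  if R = ⊤ then Filter.atTop else nhdsWithin R.toReal (Set.Iio R.toReal)

/-- A profile solution on `(0,R)`: a C² pair `(u,v)` solving the radial ODE system with the
natural boundary conditions at `0` and at `R`. -/
structure ProfileSolution (a2 b2 c2 : ℝ) (k : ℤ) (R : ℝ≥0∞) (u v : ℝ → ℝ) : Prop where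
  smooth_u : ContDiffOn ℝ 2 u (Iset R)
  smooth_v : ContDiffOn ℝ 2 v (Iset R)
  ode_u : ∀ r ∈ Iset R,
    deriv (deriv u) r + deriv u r / r - (k : ℝ) ^ 2 / r ^ 2 * u r
      = hfun a2 b2 c2 (u r) (v r)
  ode_v : ∀ r ∈ Iset R,
    deriv (deriv v) r + deriv v r / r = gfun a2 b2 c2 (u r) (v r)
  bc0_u : Filter.Tendsto u (nhdsWithin 0 (Set.Ioi 0)) (nhds 0)
  bc0_v : Filter.Tendsto (deriv v) (nhdsWithin 0 (Set.Ioi 0)) (nhds 0)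
  bcR_u : Filter.Tendsto u (endFilter R) (nhds (sPlus a2 b2 c2 / Real.sqrt 2))
  bcR_v : Filter.Tendsto v (endFilter R) (nhds (-(sPlus a2 b2 c2 / Real.sqrt 6)))

/-- At a local maximum the second derivative is nonpositive. -/
theorem IsLocalMax.second_deriv_nonpos {f f' : ℝ → ℝ} {m d : ℝ} (hm : IsLocalMax f m)
    (hf : ∀ᶠ x in 𝓝 m, HasDerivAt f (f' x) x) (hf' : HasDerivAt f' d m) : d ≤ 0 := by
  by_contra! hd
  have heq : deriv f =ᶠ[𝓝 m] f' := hf.mono fun x hx => hx.deriv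
  have hmin : IsLocalMin f m := by
    refine isLocalMin_of_deriv_deriv_pos ?_ ?_ hf.self_of_nhds.continuousAt
    · rw [heq.deriv_eq, hf'.deriv]; exact hd
    · exact hm.deriv_eq_zero
  have hconst : f =ᶠ[𝓝 m] fun _ => f m := by
    filter_upwards [hm, hmin] with x h1 h2 using le_antisymm h1 h2
  have hzero : f' =ᶠ[𝓝 m] fun _ => 0 := by
    filter_upwards [heq, hconst.deriv] with x h1 h2
    rw [← h1, h2, deriv_const]
  have := hf'.unique ((hasDerivAt_const m (0 : ℝ)).congr_of_eventuallyEq hzero)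
  linarith

/-- The right derivative of the negative part `min f 0`. -/
theorem HasDerivAt.exists_hasDerivWithinAt_min_zero {f : ℝ → ℝ} {d x : ℝ}
    (hf : HasDerivAt f d x) :
    ∃ e, HasDerivWithinAt (fun y => min (f y) 0) e (Ici x) x ∧ d * e = e ^ 2 ∧
      d * min (f x) 0 = e * min (f x) 0 := by
  rcases lt_trichotomy (f x) 0 with hx | hx | hx
  · refine ⟨d, (hf.congr_of_eventuallyEq ?_).hasDerivWithinAt, by ring, rfl⟩
    filter_upwards [hf.continuousAt.eventually_lt continuousAt_const hx] with y hy
    exact min_eq_left hy.le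
  · refine ⟨min d 0, ?_, ?_, by simp [hx]⟩
    · rw [← hasDerivWithinAt_Ioi_iff_Ici, hasDerivWithinAt_iff_tendsto_slope' (by simp)]
      have h := (hasDerivWithinAt_iff_tendsto_slope' (s := Ioi x) (by simp)).1
        hf.hasDerivWithinAt
      refine (h.min tendsto_const_nhds).congr' ?_
      filter_upwards [self_mem_nhdsWithin] with y hy
      have hy : 0 < (y - x)⁻¹ := inv_pos.2 (sub_pos.2 hy)
      simp only [slope, hx, vsub_eq_sub, smul_eq_mul, min_self, sub_zero]
      rw [mul_min_of_nonneg _ _ hy.le, mul_zero]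
    · rcases le_total d 0 with h | h <;> simp [h, sq]
  · refine ⟨0, ((hasDerivAt_const x (0 : ℝ)).congr_of_eventuallyEq ?_).hasDerivWithinAt,
      by simp, by simp [hx.le]⟩
    filter_upwards [continuousAt_const.eventually_lt hf.continuousAt hx] with y hy
    exact min_eq_right hy.le

theorem le_of_hasDerivWithinAt_right_nonneg {f : ℝ → ℝ} {x y : ℝ} (hxy : x ≤ y)
    (hc : ContinuousOn f (Icc x y))
    (hd : ∀ z ∈ Icc x y, ∃ d, 0 ≤ d ∧ HasDerivWithinAt f d (Ici z) z) : f x ≤ f y := by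
  choose! d hd0 hd using hd
  have := image_le_of_deriv_right_le_deriv_boundary (f := fun z => -f z) (f' := fun z => -d z)
    (B := fun _ => -f x) (B' := fun _ => 0) hc.neg
    (fun z hz => (hd z (Ico_subset_Icc_self hz)).neg) le_rfl continuousOn_const
    (fun z _ => hasDerivWithinAt_const _ _ _)
    (fun z hz => neg_nonpos.2 (hd0 z (Ico_subset_Icc_self hz))) (right_mem_Icc.2 hxy)
  linarith [show -f y ≤ -f x from this]

/-- `I` is `(0, T)` or `(0, ∞)`, and `F` is the filter of approach to its right end. -/
def IsRadialInterval (I : Set ℝ) (F : Filter ℝ) : Prop :=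
  (I = Ioi 0 ∧ F = atTop) ∨ ∃ T, 0 < T ∧ I = Ioo 0 T ∧ F = 𝓝[<] T

namespace IsRadialInterval

variable {I : Set ℝ} {F : Filter ℝ} (h : IsRadialInterval I F)
include h

theorem pos {r : ℝ} (hr : r ∈ I) : 0 < r := by
  rcases h with ⟨rfl, -⟩ | ⟨T, -, rfl, -⟩
  exacts [hr, hr.1]

theorem mem_of_le {x r : ℝ} (hr : r ∈ I) (hx : 0 < x) (hxr : x ≤ r) : x ∈ I := by
  rcases h with ⟨rfl, -⟩ | ⟨T, -, rfl, -⟩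
  exacts [hx, ⟨hx, hxr.trans_lt hr.2⟩]

theorem isOpen : IsOpen I := by
  rcases h with ⟨rfl, -⟩ | ⟨T, -, rfl, -⟩
  exacts [isOpen_Ioi, isOpen_Ioo]

theorem neBot : F.NeBot := by
  rcases h with ⟨-, rfl⟩ | ⟨T, -, -, rfl⟩ <;> infer_instance

theorem Icc_subset {x y : ℝ} (hx : x ∈ I) (hy : y ∈ I) : Icc x y ⊆ I :=
  fun _ hz => h.mem_of_le hy ((h.pos hx).trans_le hz.1) hz.2

theorem eventually_gt {r : ℝ} (hr : r ∈ I) : ∀ᶠ x in F, x ∈ I ∧ r < x := by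
  rcases h with ⟨rfl, rfl⟩ | ⟨T, -, rfl, rfl⟩
  · filter_upwards [eventually_gt_atTop r] with x hx using ⟨lt_trans hr hx, hx⟩
  · filter_upwards [Ioo_mem_nhdsLT hr.2] with x hx using ⟨⟨hr.1.trans hx.1, hx.2⟩, hx.1⟩

theorem eventually_lt {r : ℝ} (hr : r ∈ I) : ∀ᶠ x in 𝓝[>] (0 : ℝ), x ∈ I ∧ x < r := by
  filter_upwards [Ioo_mem_nhdsGT (h.pos hr)] with x hx
    using ⟨h.mem_of_le hr hx.1 hx.2.le, hx.2⟩

theorem nonempty : I.Nonempty := by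
  rcases h with ⟨rfl, -⟩ | ⟨T, hT, rfl, -⟩
  exacts [⟨1, mem_Ioi.2 one_pos⟩, ⟨T / 2, by positivity, half_lt_self hT⟩]

theorem exists_forall_ge {p : ℝ → Prop} (hp : ∀ᶠ x in F, p x) :
    ∃ r ∈ I, ∀ x ∈ I, r ≤ x → p x := by
  rcases h with ⟨rfl, rfl⟩ | ⟨T, hT, rfl, rfl⟩
  · obtain ⟨r, hr⟩ := eventually_atTop.1 hp
    exact ⟨max r 1, by simp, fun x _ hx => hr x ((le_max_left _ _).trans hx)⟩
  · obtain ⟨r, hr, hp⟩ := (mem_nhdsLT_iff_exists_Ioo_subset' hT).1 hp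
    refine ⟨(max r 0 + T) / 2, ⟨?_, ?_⟩, fun x hx hrx => hp ⟨?_, hx.2⟩⟩
    · linarith [le_max_right r 0]
    · linarith [max_lt hr hT]
    · have := max_lt hr hT
      linarith [le_max_left r 0]

theorem exists_forall_le {p : ℝ → Prop} (hp : ∀ᶠ x in 𝓝[>] (0 : ℝ), p x) :
    ∃ r ∈ I, ∀ x, 0 < x → x ≤ r → p x := by
  obtain ⟨r, hr⟩ := h.nonempty
  obtain ⟨x, hx, hp⟩ := (mem_nhdsGT_iff_exists_Ioc_subset).1 hp
  have hx : 0 < x := hx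
  exact ⟨min r x, h.mem_of_le hr (lt_min (h.pos hr) hx) (min_le_left _ _),
    fun y hy hyr => hp ⟨hy, hyr.trans (min_le_right _ _)⟩⟩

/-- Maximum principle for radially symmetric functions in the plane. -/
theorem le_of_laplacian_pos {f f' f'' : ℝ → ℝ} {L : ℝ}
    (hf : ∀ r ∈ I, HasDerivAt f (f' r) r) (hf' : ∀ r ∈ I, HasDerivAt f' (f'' r) r)
    (hzero : ∀ ε > 0, ∀ᶠ r in 𝓝[>] (0 : ℝ), -ε < r * f' r) (hlim : Tendsto f F (𝓝 L))
    (hpos : ∀ r ∈ I, L < f r → 0 < f'' r + f' r / r) : ∀ r ∈ I, f r ≤ L := by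
  have hnomax : ∀ m ∈ I, L < f m → ¬ IsLocalMax f m := fun m hm hL hmax => by
    have h1 := hmax.second_deriv_nonpos
      ((h.isOpen.eventually_mem hm).mono hf) (hf' m hm)
    have h2 := hpos m hm hL
    rw [hmax.hasDerivAt_eq_zero (hf m hm), zero_div] at h2
    linarith
  have hanti : ∀ x ∈ I, ∀ y ∈ I, x ≤ y → L < f y → f y ≤ f x := fun x hx y hy hxy hL => by
    have := h.neBot
    obtain ⟨z, hz, hzI, hyz⟩ := ((hlim.eventually_lt_const hL).and (h.eventually_gt hy)).exists
    obtain ⟨m, hm, hmax⟩ := isCompact_Icc.exists_isMaxOn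
      (nonempty_Icc.2 (hxy.trans hyz.le))
      (fun t ht => (hf t (h.Icc_subset hx hzI ht)).continuousAt.continuousWithinAt)
    have hym : f y ≤ f m := hmax ⟨hxy, hyz.le⟩
    rcases hm.1.eq_or_lt with rfl | hxm
    · exact hym
    rcases hm.2.eq_or_lt with rfl | hmz
    · linarith
    exact absurd (hmax.isLocalMax (Icc_mem_nhds hxm hmz))
      (hnomax m (h.Icc_subset hx hzI hm) (hL.trans_le hym))
  intro r hr
  by_contra! hL
  have hL' : ∀ x ∈ Ioc 0 r, L < f x := fun x hx =>
    hL.trans_le (hanti x (h.mem_of_le hr hx.1 hx.2) r hr hx.2 hL)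
  have hmem : ∀ x ∈ Ioc 0 r, x ∈ I := fun x hx => h.mem_of_le hr hx.1 hx.2
  have hg : ∀ x ∈ Ioc 0 r, HasDerivAt (fun x => x * f' x) (1 * f' x + x * f'' x) x :=
    fun x hx => (hasDerivAt_id x).mul (hf' x (hmem x hx))
  have hmono : StrictMonoOn (fun x => x * f' x) (Ioc 0 r) := by
    refine strictMonoOn_of_deriv_pos (convex_Ioc 0 r)
      (fun x hx => (hg x hx).continuousAt.continuousWithinAt) fun x hx => ?_
    have hx := interior_subset hx
    rw [(hg x hx).deriv]
    have := mul_pos hx.1 (hpos x (hmem x hx) (hL' x hx))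
    rw [mul_add, mul_div_cancel₀ _ hx.1.ne'] at this
    linarith
  have hr0 := h.pos hr
  have hrr : r ∈ Ioc 0 r := ⟨hr0, le_rfl⟩
  have hr2 : r / 2 ∈ Ioc 0 r := ⟨by linarith, by linarith⟩
  have hneg : f' r ≤ 0 := by
    have hslope := (hasDerivWithinAt_iff_tendsto_slope' (s := Iio r) (by simp)).1
      (hf r hr).hasDerivWithinAt
    refine le_of_tendsto hslope ?_
    filter_upwards [Ioo_mem_nhdsLT hr0] with x hx
    have h1 := hanti x (hmem x ⟨hx.1, hx.2.le⟩) r hr hx.2.le hL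
    rw [slope_comm, slope_def_field]
    exact div_nonpos_of_nonpos_of_nonneg (by linarith) (by linarith [hx.2])
  have h1 : r / 2 * f' (r / 2) < r * f' r := hmono hr2 hrr (by linarith)
  have h2 : r * f' r ≤ 0 := mul_nonpos_of_nonneg_of_nonpos hr0.le hneg
  obtain ⟨x, hx, hx0, hxr⟩ := ((hzero (-(r / 2 * f' (r / 2))) (by linarith)).and
    (Ioo_mem_nhdsGT hr2.1)).exists
  have h3 : x * f' x < r / 2 * f' (r / 2) := hmono ⟨hx0, by linarith⟩ hr2 hxr
  linarith

/-- A function with bounded radial Laplacian which stays bounded towards the right end has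
bounded derivative there. -/
theorem exists_deriv_bound {f f' f'' : ℝ → ℝ} {M C r₀ : ℝ} (hr₀ : r₀ ∈ I)
    (hf : ∀ r ∈ I, HasDerivAt f (f' r) r) (hf' : ∀ r ∈ I, HasDerivAt f' (f'' r) r)
    (hM : ∀ r ∈ I, r₀ ≤ r → |f r| ≤ M) (hC : ∀ r ∈ I, r₀ ≤ r → |f'' r + f' r / r| ≤ C) :
    ∃ B, ∀ r ∈ I, r₀ ≤ r → |f' r| ≤ B := by
  have hr0 := h.pos hr₀
  have hM0 : 0 ≤ M := (abs_nonneg _).trans (hM r₀ hr₀ le_rfl)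
  have hC0 : 0 ≤ C := (abs_nonneg _).trans (hC r₀ hr₀ le_rfl)
  have key : ∀ x ∈ I, ∀ y ∈ I, r₀ ≤ x → x ≤ y →
      |y * f' y - x * f' x| ≤ C * y * (y - x) := fun x hx y hy hrx hxy => by
    have hmem := h.Icc_subset hx hy
    have := (convex_Icc x y).norm_image_sub_le_of_norm_hasDerivWithin_le
      (f := fun x => x * f' x) (f' := fun x => 1 * f' x + x * f'' x) (C := C * y)
      (fun t ht => ((hasDerivAt_id t).mul (hf' t (hmem ht))).hasDerivWithinAt)
      (fun t ht => ?_) (left_mem_Icc.2 hxy) (right_mem_Icc.2 hxy)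
    · simpa [Real.norm_eq_abs, abs_of_nonneg (sub_nonneg.2 hxy)] using this
    · have ht0 := h.pos (hmem ht)
      have h1 : 1 * f' t + t * f'' t = t * (f'' t + f' t / t) := by field_simp; ring
      rw [h1, norm_mul, Real.norm_eq_abs, Real.norm_eq_abs, abs_of_pos ht0, mul_comm]
      exact mul_le_mul (hC t (hmem ht) (hrx.trans ht.1)) ht.2 ht0.le hC0
  rcases id h with ⟨hI, -⟩ | ⟨T, hT, hI, -⟩
  · refine ⟨(2 * M + C) * (1 + 1 / r₀), fun r hr hrr => ?_⟩
    have hrp := h.pos hr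
    have hmem : ∀ t, r ≤ t → t ∈ I := fun t ht => by
      rw [hI]; exact hrp.trans_le ht
    obtain ⟨ξ, hξ, hs⟩ := exists_hasDerivAt_eq_slope f f' (lt_add_one r)
      (fun t ht => (hf t (hmem t ht.1)).continuousAt.continuousWithinAt)
      (fun t ht => hf t (hmem t ht.1.le))
    have h1 : |f' ξ| ≤ 2 * M := by
      rw [hs, add_sub_cancel_left, div_one]
      have := abs_sub (f (r + 1)) (f r)
      linarith [hM r hr hrr, hM (r + 1) (hmem _ (by linarith)) (by linarith)]
    have h2 := key r hr ξ (hmem ξ hξ.1.le) hrr hξ.1.le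
    have h3 : C * ξ * (ξ - r) ≤ C * (r + 1) := by
      have : ξ * (ξ - r) ≤ (r + 1) * 1 :=
        mul_le_mul hξ.2.le (by linarith [hξ.2]) (by linarith [hξ.1]) (by linarith)
      nlinarith
    have h4 : |ξ * f' ξ| ≤ (r + 1) * (2 * M) := by
      rw [abs_mul, abs_of_pos (hrp.trans hξ.1)]
      exact mul_le_mul hξ.2.le h1 (abs_nonneg _) (by linarith)
    have h5 : r * |f' r| ≤ (2 * M + C) * (r + 1) := by
      rw [← abs_of_pos hrp, ← abs_mul, abs_of_pos hrp]
      have := abs_sub_abs_le_abs_sub (r * f' r) (ξ * f' ξ)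
      rw [abs_sub_comm] at this
      linarith
    have h6 : r + 1 ≤ r * (1 + 1 / r₀) := by
      have : 1 ≤ r / r₀ := (one_le_div hr0).2 hrr
      calc r + 1 ≤ r + r / r₀ := by linarith
        _ = r * (1 + 1 / r₀) := by ring
    refine le_of_mul_le_mul_left ?_ hrp
    calc r * |f' r| ≤ (2 * M + C) * (r + 1) := h5
      _ ≤ (2 * M + C) * (r * (1 + 1 / r₀)) := mul_le_mul_of_nonneg_left h6 (by linarith)
      _ = r * ((2 * M + C) * (1 + 1 / r₀)) := by ring
  · refine ⟨(|r₀ * f' r₀| + C * T * T) / r₀, fun r hr hrr => ?_⟩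
    have hrT : r < T := by rw [hI] at hr; exact hr.2
    have h1 := key r₀ hr₀ r hr le_rfl hrr
    have h2 : C * r * (r - r₀) ≤ C * T * T := by
      have : r * (r - r₀) ≤ T * T :=
        mul_le_mul hrT.le (by linarith) (by linarith) hT.le
      nlinarith
    have h3 : r * |f' r| ≤ |r₀ * f' r₀| + C * T * T := by
      rw [← abs_of_pos (h.pos hr), ← abs_mul, abs_of_pos (h.pos hr)]
      linarith [abs_sub_abs_le_abs_sub (r * f' r) (r₀ * f' r₀)]
    rw [le_div_iff₀ hr0]
    nlinarith [abs_nonneg (f' r)]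

/-- If `f ≤ L`, `f → L` at the right end, and `f'`, `f''` are bounded there, then the negative
part of `f' / r` vanishes at the right end. -/
theorem eventually_neg_le_deriv {f f' f'' : ℝ → ℝ} {L B r₀ : ℝ} (hr₀ : r₀ ∈ I)
    (hf : ∀ r ∈ I, HasDerivAt f (f' r) r) (hf' : ∀ r ∈ I, HasDerivAt f' (f'' r) r)
    (hle : ∀ r ∈ I, f r ≤ L) (hlim : Tendsto f F (𝓝 L))
    (hB' : ∀ r ∈ I, r₀ ≤ r → |f' r| ≤ B) (hB : ∀ r ∈ I, r₀ ≤ r → |f'' r| ≤ B)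
    {ε : ℝ} (hε : 0 < ε) : ∀ᶠ r in F, -(ε * r) ≤ f' r := by
  have hB0 : 0 ≤ B := (abs_nonneg _).trans (hB r₀ hr₀ le_rfl)
  have hr0 := h.pos hr₀
  rcases id h with ⟨hI, hF⟩ | ⟨T, hT, hI, hF⟩
  · subst hF
    filter_upwards [h.eventually_gt hr₀, eventually_ge_atTop (B / ε)] with r hr hrB
    rw [div_le_iff₀ hε] at hrB
    have := (abs_le.1 (hB' r hr.1 hr.2.le)).1
    linarith
  · have hpt : ∀ r ∈ I, r₀ ≤ r → -(B * (T - r)) ≤ f' r := fun r hr hrr => by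
      by_contra! hlt
      have hneg : ∀ t ∈ I, r ≤ t → f' t < 0 := fun t ht hrt => by
        have hmem := h.Icc_subset hr ht
        have := (convex_Icc r t).norm_image_sub_le_of_norm_hasDerivWithin_le
          (f := f') (f' := f'') (C := B)
          (fun x hx => (hf' x (hmem hx)).hasDerivWithinAt)
          (fun x hx => hB x (hmem hx) (hrr.trans hx.1)) (left_mem_Icc.2 hrt)
          (right_mem_Icc.2 hrt)
        rw [Real.norm_eq_abs, Real.norm_eq_abs, abs_of_nonneg (sub_nonneg.2 hrt)] at this
        have h1 := (abs_le.1 this).2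
        rw [hI] at ht
        nlinarith [ht.2]
      have hanti : ∀ x ∈ I, ∀ y ∈ I, r ≤ x → x < y → f y < f x := fun x hx y hy hrx hxy => by
        have hmem := h.Icc_subset hx hy
        refine strictAntiOn_of_deriv_neg (convex_Icc x y)
          (fun t ht => (hf t (hmem ht)).continuousAt.continuousWithinAt) (fun t ht => ?_)
          (left_mem_Icc.2 hxy.le) (right_mem_Icc.2 hxy.le) hxy
        have ht := interior_subset ht
        rw [(hf t (hmem ht)).deriv]
        exact hneg t (hmem ht) (hrx.trans ht.1)
      have := h.neBot
      obtain ⟨x, hx, hrx⟩ := (h.eventually_gt hr).exists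
      have hL : L ≤ f x := le_of_tendsto hlim
        ((h.eventually_gt hx).mono fun y hy => (hanti x hx y hy.1 hrx.le hy.2).le)
      linarith [hanti r hr x hx le_rfl hrx, hle r hr]
    have hlimT : Tendsto (fun r => B * (T - r)) F (𝓝 0) := by
      have : Tendsto (fun r => B * (T - r)) (𝓝 T) (𝓝 (B * (T - T))) :=
        (continuous_const.mul (continuous_const.sub continuous_id)).tendsto T
      rw [sub_self, mul_zero] at this
      rw [hF]
      exact this.mono_left nhdsWithin_le_nhds
    filter_upwards [h.eventually_gt hr₀, hlimT.eventually_lt_const (mul_pos hε hr0)]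
      with r hr hrB
    have := hpt r hr.1 hr.2.le
    nlinarith [hr.2]

end IsRadialInterval

/-- The reaction term of the equation for `U = √2 u`. -/
def reactionU (a b c p q : ℝ) : ℝ := p * (-a - b * q / 3 + c * (p ^ 2 / 2 + q ^ 2 / 6))

/-- The reaction term of the equation for `V = -√6 v`. -/
def reactionV (a b c p q : ℝ) : ℝ :=
  q * (-a + b * q / 6 + c * (p ^ 2 / 2 + q ^ 2 / 6)) - b * p ^ 2 / 2

/-- Positive solutions of the profile system in the variables `U = √2 u`, `V = -√6 v`, in which
both components tend to `s` at the right end. -/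
structure RescaledProfile (a b c K s : ℝ) (I : Set ℝ) (F : Filter ℝ) (U V U' V' : ℝ → ℝ) :
    Prop where
  b_pos : 0 < b
  c_pos : 0 < c
  one_le_K : 1 ≤ K
  s_pos : 0 < s
  s_eq : 2 * c * s ^ 2 = b * s + 3 * a
  b_lt : b < c * s
  domain : IsRadialInterval I F
  U_pos : ∀ r ∈ I, 0 < U r
  V_pos : ∀ r ∈ I, 0 < V r
  hasDerivAt_U : ∀ r ∈ I, HasDerivAt U (U' r) r
  hasDerivAt_V : ∀ r ∈ I, HasDerivAt V (V' r) r
  hasDerivAt_U' : ∀ r ∈ I,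
    HasDerivAt U' (-U' r / r + K / r ^ 2 * U r + reactionU a b c (U r) (V r)) r
  hasDerivAt_V' : ∀ r ∈ I, HasDerivAt V' (-V' r / r + reactionV a b c (U r) (V r)) r
  tendsto_zero_U : Tendsto U (𝓝[>] 0) (𝓝 0)
  tendsto_zero_V' : Tendsto V' (𝓝[>] 0) (𝓝 0)
  tendsto_end_U : Tendsto U F (𝓝 s)
  tendsto_end_V : Tendsto V F (𝓝 s)

/-- The derivative of one component of the flux, for `f'' = -f' / r + q f` with `p = f'`,
`W = f''` and `m` the negative part of `p` with right derivative `e`. -/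
theorem flux_component_deriv {r f p m e W q X : ℝ} (hr : r ≠ 0) (hf : f ≠ 0)
    (hW : W = -p / r + q * f) (hWe : W * e = e ^ 2) (hWm : W * m = e * m)
    (hpm : p * m = m ^ 2) :
    (W * m - m ^ 3 / f) + r * ((-W / r + p / r ^ 2 + q * p + X) * m + W * e -
      (3 * m ^ 2 * e * f - m ^ 3 * p) / f ^ 2) =
    r * ((e - m ^ 2 / f) ^ 2 + m ^ 2 / r ^ 2 + X * m) := by
  rcases eq_or_ne m 0 with rfl | hm
  · rw [hWe]
    ring
  · obtain rfl : W = e := mul_right_cancel₀ hm hWm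
    obtain rfl : p = m := mul_right_cancel₀ hm (hpm.trans (sq m))
    have hq : q = (W + p / r) / f := by rw [hW]; field_simp; ring
    rw [hq]
    field_simp
    ring

namespace RescaledProfile

variable {a b c K s : ℝ} {I : Set ℝ} {F : Filter ℝ} {U V U' V' : ℝ → ℝ}
  (S : RescaledProfile a b c K s I F U V U' V')
include S

theorem exists_V_bound_zero : ∃ M, 0 ≤ M ∧ ∀ᶠ r in 𝓝[>] (0 : ℝ), V r ≤ M := by
  have h1 : ∀ᶠ r in 𝓝[>] (0 : ℝ), |V' r| < 1 := by
    have := S.tendsto_zero_V'.abs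
    rw [abs_zero] at this
    exact this.eventually_lt_const one_pos
  obtain ⟨r, hr, hb⟩ := S.domain.exists_forall_le h1
  have hr0 := S.domain.pos hr
  refine ⟨V r + r, by linarith [S.V_pos r hr], ?_⟩
  filter_upwards [Ioo_mem_nhdsGT hr0] with x hx
  have hmem := S.domain.Icc_subset (S.domain.mem_of_le hr hx.1 hx.2.le) hr
  have := (convex_Icc x r).norm_image_sub_le_of_norm_hasDerivWithin_le
    (f := V) (f' := V') (C := 1)
    (fun t ht => (S.hasDerivAt_V t (hmem ht)).hasDerivWithinAt)
    (fun t ht => (hb t (hx.1.trans_le ht.1) ht.2).le) (left_mem_Icc.2 hx.2.le)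
    (right_mem_Icc.2 hx.2.le)
  rw [Real.norm_eq_abs, Real.norm_eq_abs, abs_of_pos (sub_pos.2 hx.2)] at this
  linarith [(abs_le.1 this).1, hx.1]

theorem eventually_U'_nonneg : ∀ᶠ r in 𝓝[>] (0 : ℝ), 0 ≤ U' r := by
  obtain ⟨M, hM, hVM⟩ := S.exists_V_bound_zero
  have hsmall : ∀ᶠ r in 𝓝[>] (0 : ℝ), r ^ 2 * (a + b * M / 3) < 1 := by
    have : Tendsto (fun r : ℝ => r ^ 2 * (a + b * M / 3)) (𝓝 0)
        (𝓝 (0 ^ 2 * (a + b * M / 3))) :=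
      ((continuous_pow 2).mul continuous_const).tendsto 0
    rw [zero_pow two_ne_zero, zero_mul] at this
    exact (this.mono_left nhdsWithin_le_nhds).eventually_lt_const one_pos
  obtain ⟨r, hr, hp⟩ := S.domain.exists_forall_le
    ((hVM.and hsmall).and (S.tendsto_zero_U.eventually_lt_const one_pos))
  have hr0 := S.domain.pos hr
  have hmem : ∀ x ∈ Ioc 0 r, x ∈ I := fun x hx => S.domain.mem_of_le hr hx.1 hx.2
  have hmono : MonotoneOn (fun x => x * U' x) (Ioc 0 r) := by
    have hg := fun x (hx : x ∈ Ioc 0 r) => (hasDerivAt_id x).mul (S.hasDerivAt_U' x (hmem x hx))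
    refine monotoneOn_of_deriv_nonneg (convex_Ioc 0 r)
      (fun x hx => (hg x hx).continuousAt.continuousWithinAt)
      (fun x hx => (hg x (interior_subset hx)).differentiableAt.differentiableWithinAt)
      fun x hx => ?_
    have hx := interior_subset hx
    refine (hg x hx).deriv.symm ▸ ?_
    obtain ⟨⟨h1, h2⟩, -⟩ := hp x hx.1 hx.2
    have hU := S.U_pos x (hmem x hx)
    have hx0 := hx.1
    have heq : 1 * U' x + id x * (-U' x / x + K / x ^ 2 * U x + reactionU a b c (U x) (V x))
        = U x / x * (K + x ^ 2 * (-a - b * V x / 3) +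
            x ^ 2 * (c * (U x ^ 2 / 2 + V x ^ 2 / 6))) := by
      simp only [reactionU, id]
      field_simp
      ring
    rw [heq]
    have h3 : 0 ≤ x ^ 2 * (c * (U x ^ 2 / 2 + V x ^ 2 / 6)) := by
      have := S.c_pos
      positivity
    have h4 : x ^ 2 * (a + b * V x / 3) ≤ x ^ 2 * (a + b * M / 3) := by
      have := S.b_pos
      gcongr
    have := S.one_le_K
    exact mul_nonneg (by positivity) (by nlinarith)
  filter_upwards [Ioc_mem_nhdsGT hr0] with x hx
  by_contra! hneg
  have hx0 := hx.1
  have hg : x * U' x < 0 := mul_neg_of_pos_of_neg hx0 hneg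
  have hsub : ∀ y ∈ Ioc 0 x, y ∈ Ioc 0 r := fun y hy => ⟨hy.1, hy.2.trans hx.2⟩
  have hder : ∀ y ∈ Ioc 0 x,
      HasDerivAt (fun y => U y - x * U' x * log y) (U' y - x * U' x * y⁻¹) y := fun y hy =>
    (S.hasDerivAt_U y (hmem y (hsub y hy))).sub ((hasDerivAt_log hy.1.ne').const_mul _)
  have hanti : AntitoneOn (fun y => U y - x * U' x * log y) (Ioc 0 x) := by
    refine antitoneOn_of_deriv_nonpos (convex_Ioc 0 x)
      (fun y hy => (hder y hy).continuousAt.continuousWithinAt)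
      (fun y hy => (hder y (interior_subset hy)).differentiableAt.differentiableWithinAt)
      fun y hy => ?_
    have hy := interior_subset hy
    rw [(hder y hy).deriv, sub_nonpos, ← div_eq_mul_inv, le_div_iff₀ hy.1, mul_comm]
    exact hmono (hsub y hy) hx hy.2
  set y := x * exp (2 / (x * U' x)) with hy
  have hy0 : 0 < y := by positivity
  have hyx : y ≤ x := by
    have : exp (2 / (x * U' x)) ≤ 1 := exp_le_one_iff.2 (div_nonpos_of_nonneg_of_nonpos two_pos.le hg.le)
    nlinarith
  have h1 : U x - x * U' x * log x ≤ U y - x * U' x * log y :=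
    hanti ⟨hy0, hyx⟩ ⟨hx0, le_rfl⟩ hyx
  have h2 : x * U' x * log y = x * U' x * log x + 2 := by
    rw [hy, log_mul hx0.ne' (exp_ne_zero _), log_exp, mul_add, mul_div_cancel₀ _ hg.ne]
  have h3 := (hp y hy0 (hyx.trans hx.2)).2
  linarith [S.U_pos x (hmem x hx)]

theorem eventually_abs_V_mul_V'_lt {ε : ℝ} (hε : 0 < ε) :
    ∀ᶠ r in 𝓝[>] (0 : ℝ), |V r * V' r| < ε := by
  obtain ⟨M, hM, hVM⟩ := S.exists_V_bound_zero
  have h1 : ∀ᶠ r in 𝓝[>] (0 : ℝ), |V' r| < ε / (M + 1) := by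
    have := S.tendsto_zero_V'.abs
    rw [abs_zero] at this
    exact this.eventually_lt_const (by positivity)
  obtain ⟨r, hr⟩ := S.domain.nonempty
  filter_upwards [h1, hVM, S.domain.eventually_lt hr] with x h1 h2 h3
  have hV := S.V_pos x h3.1
  rw [abs_mul, abs_of_pos hV]
  rw [lt_div_iff₀ (by positivity)] at h1
  nlinarith [abs_nonneg (V' x)]

theorem a_pos : 0 < a := by
  have h1 := mul_pos S.s_pos (sub_pos.2 S.b_lt)
  have h2 := mul_pos S.c_pos (pow_pos S.s_pos 2)
  linarith [S.s_eq]

theorem norm_sq_le : ∀ r ∈ I, 3 * U r ^ 2 + V r ^ 2 ≤ 4 * s ^ 2 := by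
  have hs := S.s_pos
  have hb := S.b_pos
  have hc := S.c_pos
  refine S.domain.le_of_laplacian_pos
    (fun r hr => (((S.hasDerivAt_U r hr).pow 2).const_mul 3).add ((S.hasDerivAt_V r hr).pow 2))
    (f' := fun r => 3 * (2 * U r ^ 1 * U' r) + 2 * V r ^ 1 * V' r)
    (f'' := fun r => 6 * (U' r * U' r +
      U r * (-U' r / r + K / r ^ 2 * U r + reactionU a b c (U r) (V r))) +
      2 * (V' r * V' r + V r * (-V' r / r + reactionV a b c (U r) (V r)))) ?_ ?_ ?_ ?_
  · intro r hr
    refine ((((S.hasDerivAt_U r hr).mul (S.hasDerivAt_U' r hr)).const_mul 6).add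
      (((S.hasDerivAt_V r hr).mul (S.hasDerivAt_V' r hr)).const_mul 2)).congr_of_eventuallyEq ?_
    exact Eventually.of_forall fun x => by simp; ring
  · intro ε hε
    obtain ⟨r, hr⟩ := S.domain.nonempty
    filter_upwards [S.eventually_U'_nonneg, S.eventually_abs_V_mul_V'_lt (half_pos hε),
      S.domain.eventually_lt hr, Ioo_mem_nhdsGT one_pos] with x h1 h2 h3 h4
    have h5 : 0 ≤ x * (U x * U' x) :=
      mul_nonneg h4.1.le (mul_nonneg (S.U_pos x h3.1).le h1)
    have h6 := (abs_lt.1 h2).1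
    have h7 : -(ε / 2) < x * (V x * V' x) := by nlinarith [h4.1, h4.2]
    linarith
  · have := (((S.tendsto_end_U.pow 2).const_mul 3).add (S.tendsto_end_V.pow 2))
    convert this using 2
    ring
  · intro r hr hL
    have hr0 := S.domain.pos hr
    have hU := S.U_pos r hr
    have hV := S.V_pos r hr
    have hK := S.one_le_K
    obtain ⟨n, hn, hn2⟩ : ∃ n, 0 < n ∧ n ^ 2 = 3 * U r ^ 2 + V r ^ 2 :=
      ⟨√(3 * U r ^ 2 + V r ^ 2), by positivity, Real.sq_sqrt (by positivity)⟩
    have hns : 2 * s < n := by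
      have hL : 4 * s ^ 2 < 3 * U r ^ 2 + V r ^ 2 := hL
      rw [← hn2] at hL
      nlinarith
    have h1 : V r * (9 * U r ^ 2 - V r ^ 2) ≤ n ^ 3 := by
      have : 0 ≤ (n + V r) * (n - 2 * V r) ^ 2 := by positivity
      linear_combination this - 3 * V r * hn2
    have h2 : 0 < -a + c * n ^ 2 / 6 - b * n / 6 := by
      have : 0 < (n - 2 * s) * (c * (n + 2 * s) - b) :=
        mul_pos (by linarith) (by nlinarith [S.b_lt])
      linarith [S.s_eq]
    have h3 : 0 < 6 * (U r * reactionU a b c (U r) (V r)) +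
        2 * (V r * reactionV a b c (U r) (V r)) := by
      have h4 : 6 * (U r * reactionU a b c (U r) (V r)) + 2 * (V r * reactionV a b c (U r) (V r))
          = 2 * n ^ 2 * (-a + c * n ^ 2 / 6) - b * (V r * (9 * U r ^ 2 - V r ^ 2)) / 3 := by
        rw [hn2, reactionU, reactionV]
        ring
      rw [h4]
      have h5 := mul_pos (pow_pos hn 2) h2
      have h6 := mul_le_mul_of_nonneg_left h1 hb.le
      linarith
    have h4 : 0 ≤ K / r ^ 2 * U r ^ 2 := by positivity
    have h5 : 6 * (U' r * U' r +
        U r * (-U' r / r + K / r ^ 2 * U r + reactionU a b c (U r) (V r))) +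
        2 * (V' r * V' r + V r * (-V' r / r + reactionV a b c (U r) (V r))) +
        (3 * (2 * U r ^ 1 * U' r) + 2 * V r ^ 1 * V' r) / r =
        6 * U' r ^ 2 + 2 * V' r ^ 2 + 6 * (K / r ^ 2 * U r ^ 2) +
        (6 * (U r * reactionU a b c (U r) (V r)) + 2 * (V r * reactionV a b c (U r) (V r))) := by
      ring
    refine h5 ▸ ?_
    positivity

theorem s_le_V : ∀ r ∈ I, s ≤ V r := by
  have hs := S.s_pos
  have hb := S.b_pos
  have hc := S.c_pos
  suffices ∀ r ∈ I, -V r ≤ -s from fun r hr => neg_le_neg_iff.1 (this r hr)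
  refine S.domain.le_of_laplacian_pos (fun r hr => (S.hasDerivAt_V r hr).neg)
    (f' := fun r => -V' r)
    (f'' := fun r => -(-V' r / r + reactionV a b c (U r) (V r)))
    (fun r hr => (S.hasDerivAt_V' r hr).neg) ?_ S.tendsto_end_V.neg ?_
  · intro ε hε
    filter_upwards [S.tendsto_zero_V'.eventually_lt_const hε, Ioo_mem_nhdsGT one_pos]
      with x h1 h2
    nlinarith [h2.1, h2.2]
  · intro r hr hL
    have hU := S.U_pos r hr
    have hV := S.V_pos r hr
    have hVs : V r < s := neg_lt_neg_iff.1 hL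
    have hN := S.norm_sq_le r hr
    suffices reactionV a b c (U r) (V r) < 0 by
      have h : -(-V' r / r + reactionV a b c (U r) (V r)) + -V' r / r =
        -reactionV a b c (U r) (V r) := by ring
      refine h ▸ ?_
      linarith
    have hG : reactionV a b c (U r) (V r) =
        (3 * U r ^ 2 + V r ^ 2) / 6 * (c * V r - b) - a * V r + b * V r ^ 2 / 3 := by
      rw [reactionV]; ring
    rw [hG]
    rcases le_total b (c * V r) with h | h
    · have h1 := mul_le_mul_of_nonneg_right hN (sub_nonneg.2 h)
      have h2 : 0 < b * ((s - V r) * (V r + 2 * s)) :=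
        mul_pos hb (mul_pos (by linarith) (by linarith))
      linear_combination h1 / 6 + h2 / 3 + (V r) / 3 * S.s_eq
    · have h1 : V r ^ 2 * (b - c * V r) ≤ (3 * U r ^ 2 + V r ^ 2) * (b - c * V r) :=
        mul_le_mul_of_nonneg_right (by nlinarith) (sub_nonneg.2 h)
      have h2 : c * V r ^ 2 + b * V r < 6 * a := by
        have h3 : V r * (c * V r) ≤ V r * b := mul_le_mul_of_nonneg_left h hV.le
        have h4 : b * V r < b * s := mul_lt_mul_of_pos_left hVs hb
        have h5 := mul_lt_mul_of_pos_right S.b_lt hs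
        linarith [S.s_eq]
      have h3 := mul_pos hV (sub_pos.2 h2)
      linarith

theorem U_le_s : ∀ r ∈ I, U r ≤ s := fun r hr => by
  have h1 := S.norm_sq_le r hr
  have h2 := S.s_le_V r hr
  nlinarith [S.s_pos, S.U_pos r hr]

theorem hasDerivAt_U'' {r : ℝ} (hr : r ∈ I) :
    HasDerivAt (fun r => -U' r / r + K / r ^ 2 * U r + reactionU a b c (U r) (V r))
      (-(-U' r / r + K / r ^ 2 * U r + reactionU a b c (U r) (V r)) / r +
        (1 + K) * U' r / r ^ 2 - 2 * K * U r / r ^ 3 +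
        (-a - b * V r / 3 + c * (3 * U r ^ 2 / 2 + V r ^ 2 / 6)) * U' r +
        U r * (c * V r - b) / 3 * V' r) r := by
  have hr0 := (S.domain.pos hr).ne'
  have hU := S.hasDerivAt_U r hr
  have hV := S.hasDerivAt_V r hr
  have hid := hasDerivAt_id r
  have h := (((S.hasDerivAt_U' r hr).neg.div hid hr0).add
    (((hasDerivAt_const r K).div (hid.pow 2) (pow_ne_zero 2 hr0)).mul hU)).add
    (hU.mul ((((hV.const_mul b).div_const 3).const_sub (-a)).add
      ((((hU.pow 2).div_const 2).add ((hV.pow 2).div_const 6)).const_mul c)))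
  refine (h.congr_deriv ?_).congr_of_eventuallyEq (Eventually.of_forall fun x => rfl)
  simp only [reactionU, id, Pi.pow_apply, Pi.neg_apply, Pi.div_apply, Pi.add_apply]
  push_cast
  field_simp
  ring

theorem hasDerivAt_V'' {r : ℝ} (hr : r ∈ I) :
    HasDerivAt (fun r => -V' r / r + reactionV a b c (U r) (V r))
      (-(-V' r / r + reactionV a b c (U r) (V r)) / r + V' r / r ^ 2 +
        U r * (c * V r - b) * U' r +
        (-a + b * V r / 3 + c * (U r ^ 2 / 2 + V r ^ 2 / 2)) * V' r) r := by
  have hr0 := (S.domain.pos hr).ne'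
  have hU := S.hasDerivAt_U r hr
  have hV := S.hasDerivAt_V r hr
  have hid := hasDerivAt_id r
  have h := ((S.hasDerivAt_V' r hr).neg.div hid hr0).add
    ((hV.mul ((((hV.const_mul b).div_const 6).const_add (-a)).add
      ((((hU.pow 2).div_const 2).add ((hV.pow 2).div_const 6)).const_mul c))).sub
      (((hU.pow 2).const_mul b).div_const 2))
  refine (h.congr_deriv ?_).congr_of_eventuallyEq (Eventually.of_forall fun x => rfl)
  simp only [reactionV, id, Pi.pow_apply, Pi.neg_apply, Pi.add_apply]
  push_cast
  field_simp
  ring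

omit S in
/-- The flux obtained by testing the linearized system against the negative parts of `U'` and
`-V'`. -/
def flux (a b c K : ℝ) (U V U' V' : ℝ → ℝ) (r : ℝ) : ℝ :=
  3 * (r * ((-U' r / r + K / r ^ 2 * U r + reactionU a b c (U r) (V r)) * min (U' r) 0 -
    min (U' r) 0 ^ 3 / U r)) +
  r * (-(-V' r / r + reactionV a b c (U r) (V r)) * min (-V' r) 0 + min (-V' r) 0 ^ 3 / V r)

set_option maxHeartbeats 1600000 in
/-- The right derivative of the flux controls the flux itself. -/
theorem exists_hasDerivWithinAt_flux {r : ℝ} (hr : r ∈ I) :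
    ∃ D, HasDerivWithinAt (flux a b c K U V U' V') D (Ici r) r ∧
      2 * |flux a b c K U V U' V' r| ≤ r * D ∧
      3 * min (U' r) 0 ^ 2 + min (-V' r) 0 ^ 2 ≤ r * D := by
  have hr0 := S.domain.pos hr
  have hU := S.U_pos r hr
  have hV := S.V_pos r hr
  have hK := S.one_le_K
  have hb := S.b_pos
  have hc := S.c_pos
  have hcV : 0 ≤ c * V r - b := by nlinarith [S.b_lt, S.s_le_V r hr]
  obtain ⟨e, he, hde, hdm⟩ := (S.hasDerivAt_U' r hr).exists_hasDerivWithinAt_min_zero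
  obtain ⟨e', he', hde', hdm'⟩ := (S.hasDerivAt_V' r hr).neg.exists_hasDerivWithinAt_min_zero
  simp only [Pi.neg_apply] at he' hdm'
  have hid := (hasDerivAt_id r).hasDerivWithinAt (s := Ici r)
  have hD := ((hid.mul (((S.hasDerivAt_U'' hr).hasDerivWithinAt.mul he).sub
    ((he.pow 3).div (S.hasDerivAt_U r hr).hasDerivWithinAt hU.ne'))).const_mul 3).add
    (hid.mul (((S.hasDerivAt_V'' hr).neg.hasDerivWithinAt.mul he').add
    ((he'.pow 3).div (S.hasDerivAt_V r hr).hasDerivWithinAt hV.ne')))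
  refine ⟨_, hD, ?_⟩
  simp only [Pi.neg_apply, Pi.mul_apply, Pi.pow_apply, Pi.div_apply, Pi.add_apply, Pi.sub_apply,
    id, flux]
  have hm0 : min (U' r) 0 ≤ 0 := min_le_right _ _
  have hn0 : min (-V' r) 0 ≤ 0 := min_le_right _ _
  have hmle : min (U' r) 0 ≤ U' r := min_le_left _ _
  have hnle : min (-V' r) 0 ≤ -V' r := min_le_left _ _
  have hm2 : U' r * min (U' r) 0 = min (U' r) 0 ^ 2 := by
    rcases le_total (U' r) 0 with h | h <;> simp [h, sq]
  have hn2 : -V' r * min (-V' r) 0 = min (-V' r) 0 ^ 2 := by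
    rcases le_total (-V' r) 0 with h | h <;> simp [h, sq]
  generalize min (U' r) 0 = m at *
  generalize min (-V' r) 0 = n at *
  clear hD he he' hid
  have hcore : ∀ P D A B Y : ℝ, P = 3 * (r * (m * A)) + r * (n * B) →
      D = 3 * (r * (A ^ 2 + m ^ 2 / r ^ 2)) + r * (B ^ 2 + n ^ 2 / r ^ 2) + r * Y → 0 ≤ Y →
      2 * |P| ≤ r * D ∧ 3 * m ^ 2 + n ^ 2 ≤ r * D := by
    intro P D A B Y hP hD hY
    have hrD : r * D = 3 * (r * A) ^ 2 + 3 * m ^ 2 + (r * B) ^ 2 + n ^ 2 + r ^ 2 * Y := by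
      rw [hD]; field_simp; ring
    have hY' : 0 ≤ r ^ 2 * Y := by positivity
    rw [hrD]
    constructor
    · have : |P| ≤ (3 * (r * A) ^ 2 + 3 * m ^ 2 + (r * B) ^ 2 + n ^ 2) / 2 := by
        rw [hP, abs_le]
        constructor <;>
          nlinarith [sq_nonneg (r * A - m), sq_nonneg (r * A + m), sq_nonneg (r * B - n),
            sq_nonneg (r * B + n)]
      linarith
    · nlinarith [sq_nonneg (r * A), sq_nonneg (r * B)]
  have hqU : -U' r / r + K / r ^ 2 * U r + reactionU a b c (U r) (V r) =
      -U' r / r + (K / r ^ 2 + (-a - b * V r / 3 + c * (U r ^ 2 / 2 + V r ^ 2 / 6))) * U r := by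
    rw [reactionU]; ring
  have hqV : -(-V' r / r + reactionV a b c (U r) (V r)) =
      -(-V' r) / r + (reactionV a b c (U r) (V r) / V r) * -V r := by
    field_simp; ring
  have hcU := flux_component_deriv (X := -2 * K * U r / r ^ 3 + c * U r ^ 2 * U' r +
    U r * (c * V r - b) / 3 * V' r) hr0.ne' hU.ne' hqU hde hdm hm2
  have hcV' := flux_component_deriv (X := (b * V r / 6 + c * V r ^ 2 / 3 +
    b * U r ^ 2 / (2 * V r)) * -V' r - U r * (c * V r - b) * U' r)
    hr0.ne' (neg_ne_zero.2 hV.ne') hqV hde' hdm' hn2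
  refine hcore _ _ (e - m ^ 2 / U r) (e' - n ^ 2 / -V r)
    (3 * ((-2 * K * U r / r ^ 3 + c * U r ^ 2 * U' r + U r * (c * V r - b) / 3 * V' r) * m) +
      ((b * V r / 6 + c * V r ^ 2 / 3 + b * U r ^ 2 / (2 * V r)) * -V' r -
        U r * (c * V r - b) * U' r) * n) ?_ ?_ ?_
  · rw [hdm, hdm']
    field_simp
    ring
  · rw [show ∀ x y z t : ℝ, 3 * (r * x) + r * y + r * (3 * z + t) =
        3 * (r * (x + z)) + r * (y + t) by intros; ring]
    rw [← hcU, ← hcV']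
    have hG : (-a + b * V r / 3 + c * (U r ^ 2 / 2 + V r ^ 2 / 2)) =
        reactionV a b c (U r) (V r) / V r + (b * V r / 6 + c * V r ^ 2 / 3 +
          b * U r ^ 2 / (2 * V r)) := by
      rw [reactionV]; field_simp; ring
    rw [hG]
    clear hcU hcV' hcore hqU hqV hG hde hde' hdm hdm'
    generalize -U' r / r + K / r ^ 2 * U r + reactionU a b c (U r) (V r) = W
    generalize -V' r / r + reactionV a b c (U r) (V r) = Z
    generalize reactionV a b c (U r) (V r) / V r = G
    generalize b * V r / 6 + c * V r ^ 2 / 3 + b * U r ^ 2 / (2 * V r) = L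
    push_cast
    ring
  · have h1 : 0 ≤ K * U r / r ^ 3 * -m := mul_nonneg (by positivity) (neg_nonneg.2 hm0)
    have h2 : 0 ≤ U r * (c * V r - b) * (-m * (-V' r - n)) :=
      mul_nonneg (mul_nonneg hU.le hcV) (mul_nonneg (neg_nonneg.2 hm0) (sub_nonneg.2 hnle))
    have h3 : 0 ≤ U r * (c * V r - b) * (-n * (U' r - m)) :=
      mul_nonneg (mul_nonneg hU.le hcV) (mul_nonneg (neg_nonneg.2 hn0) (sub_nonneg.2 hmle))
    have h4 : 0 ≤ b * U r * (m * n) :=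
      mul_nonneg (mul_nonneg hb.le hU.le) (mul_nonneg_of_nonpos_of_nonpos hm0 hn0)
    have h5 : 0 ≤ c * (3 * U r * m - V r * n) ^ 2 := by positivity
    have h6 : 0 ≤ (b * V r / 6 + b * U r ^ 2 / (2 * V r)) * n ^ 2 := by positivity
    linear_combination 6 * h1 + h2 + h3 + 2 * h4 + h5 / 3 + h6 - 3 * c * U r ^ 2 * hm2 -
      (b * V r / 6 + c * V r ^ 2 / 3 + b * U r ^ 2 / (2 * V r)) * hn2

theorem continuousAt_flux {r : ℝ} (hr : r ∈ I) : ContinuousAt (flux a b c K U V U' V') r := by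
  have hU' := (S.hasDerivAt_U' r hr).continuousAt
  have hV' := (S.hasDerivAt_V' r hr).continuousAt
  exact ((continuousAt_id.mul (((S.hasDerivAt_U'' hr).continuousAt.mul
    (hU'.min continuousAt_const)).sub (((hU'.min continuousAt_const).pow 3).div
    (S.hasDerivAt_U r hr).continuousAt (S.U_pos r hr).ne'))).const_mul 3).add
    (continuousAt_id.mul (((S.hasDerivAt_V'' hr).continuousAt.neg.mul
    (hV'.neg.min continuousAt_const)).add (((hV'.neg.min continuousAt_const).pow 3).div
    (S.hasDerivAt_V r hr).continuousAt (S.V_pos r hr).ne')))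

theorem flux_mono {x y : ℝ} (hx : x ∈ I) (hy : y ∈ I) (hxy : x ≤ y) :
    flux a b c K U V U' V' x ≤ flux a b c K U V U' V' y := by
  have hmem := S.domain.Icc_subset hx hy
  refine le_of_hasDerivWithinAt_right_nonneg hxy
    (fun z hz => (S.continuousAt_flux (hmem hz)).continuousWithinAt) fun z hz => ?_
  obtain ⟨D, hD, -, h⟩ := S.exists_hasDerivWithinAt_flux (hmem hz)
  refine ⟨D, nonneg_of_mul_nonneg_right ?_ (S.domain.pos (hmem hz)), hD⟩
  exact le_trans (by positivity) h

theorem flux_div_sq_mono {x y : ℝ} (hx : x ∈ I) (hy : y ∈ I) (hxy : x ≤ y) :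
    flux a b c K U V U' V' x / x ^ 2 ≤ flux a b c K U V U' V' y / y ^ 2 := by
  have hmem := S.domain.Icc_subset hx hy
  refine le_of_hasDerivWithinAt_right_nonneg
    (f := fun z => flux a b c K U V U' V' z / z ^ 2) hxy
    (fun z hz => ((S.continuousAt_flux (hmem hz)).div (continuousAt_id.pow 2)
      (pow_ne_zero 2 (S.domain.pos (hmem hz)).ne')).continuousWithinAt) fun z hz => ?_
  have hz0 := S.domain.pos (hmem hz)
  obtain ⟨D, hD, h, -⟩ := S.exists_hasDerivWithinAt_flux (hmem hz)
  refine ⟨_, ?_, hD.div ((hasDerivWithinAt_id z _).pow 2) (pow_ne_zero 2 hz0.ne')⟩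
  refine div_nonneg ?_ (by positivity)
  simp only [id]
  have h1 : 0 ≤ z * (z * D - 2 * flux a b c K U V U' V' z) :=
    mul_nonneg hz0.le (by linarith [le_abs_self (flux a b c K U V U' V' z)])
  push_cast
  linarith

theorem flux_nonneg : ∀ r ∈ I, 0 ≤ flux a b c K U V U' V' r := by
  intro r hr
  obtain ⟨M, hM, hVM⟩ := S.exists_V_bound_zero
  have hb := S.b_pos
  have hc := S.c_pos
  have hs := S.s_pos
  by_contra! hneg
  set ε := -flux a b c K U V U' V' r with hε
  set Q := 1 + (a * M + b * M ^ 2 / 6 + c * M * (1 / 2 + M ^ 2 / 6) + b / 2) + 1 / s with hQ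
  have ha := S.a_pos
  have hQ0 : 0 < Q := by positivity
  have hV'0 : ∀ {δ : ℝ}, 0 < δ → ∀ᶠ x in 𝓝[>] (0 : ℝ), |V' x| < δ := fun hδ => by
    have := S.tendsto_zero_V'.abs
    rw [abs_zero] at this
    exact this.eventually_lt_const hδ
  have hε0 : 0 < ε := by linarith
  obtain ⟨x, ⟨⟨⟨hVx, hUx⟩, hU'x⟩, ⟨hV1, hV2⟩⟩, ⟨hx, hxr⟩, hx0, hx1⟩ :=
    ((((hVM.and (S.tendsto_zero_U.eventually_lt_const one_pos)).and S.eventually_U'_nonneg).and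
    ((hV'0 one_pos).and (hV'0 (div_pos hε0 hQ0)))).and
    ((S.domain.eventually_lt hr).and (Ioo_mem_nhdsGT one_pos))).exists
  have hmono := S.flux_mono hx hr hxr.le
  have hU := S.U_pos x hx
  have hV := S.V_pos x hx
  have hsV := S.s_le_V x hx
  have hn0 : min (-V' x) 0 ≤ 0 := min_le_right _ _
  have hnabs : |min (-V' x) 0| ≤ |V' x| := by
    rcases le_total (-V' x) 0 with h | h <;> simp [h]
  have hG : |reactionV a b c (U x) (V x)| ≤
      a * M + b * M ^ 2 / 6 + c * M * (1 / 2 + M ^ 2 / 6) + b / 2 := by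
    have h1 : V x * (U x ^ 2 / 2 + V x ^ 2 / 6) ≤ M * (1 / 2 + M ^ 2 / 6) := by
      have : U x ^ 2 ≤ 1 := by nlinarith
      gcongr
    have h2 : V x ^ 2 ≤ M ^ 2 := by gcongr
    have h3 : U x ^ 2 ≤ 1 := by nlinarith
    have e1 : 0 ≤ c * (V x * (U x ^ 2 / 2 + V x ^ 2 / 6)) := by positivity
    have e2 : c * (V x * (U x ^ 2 / 2 + V x ^ 2 / 6)) ≤ c * (M * (1 / 2 + M ^ 2 / 6)) := by gcongr
    have e3 : b * V x ^ 2 ≤ b * M ^ 2 := by gcongr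
    have e4 : 0 ≤ b * V x ^ 2 := by positivity
    have e5 : a * V x ≤ a * M := by gcongr
    have e6 : 0 ≤ a * V x := by positivity
    have e7 : b * U x ^ 2 ≤ b * 1 := by gcongr
    have e8 : 0 ≤ b * U x ^ 2 := by positivity
    rw [reactionV, abs_le]
    constructor <;> linarith
  have hflux : flux a b c K U V U' V' x =
      (V' x - x * reactionV a b c (U x) (V x) + x * (min (-V' x) 0 ^ 2 / V x)) *
        min (-V' x) 0 := by
    rw [flux, min_eq_right hU'x]
    field_simp
    ring
  have hn2 : min (-V' x) 0 ^ 2 / V x ≤ 1 / s := by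
    have : min (-V' x) 0 ^ 2 ≤ 1 := by
      rw [sq_le_one_iff_abs_le_one]
      linarith
    gcongr
  have hbound : |V' x - x * reactionV a b c (U x) (V x) + x * (min (-V' x) 0 ^ 2 / V x)| ≤ Q := by
    have h1 := abs_add_le (V' x - x * reactionV a b c (U x) (V x)) (x * (min (-V' x) 0 ^ 2 / V x))
    have h2 := abs_sub (V' x) (x * reactionV a b c (U x) (V x))
    have h3 : |x * reactionV a b c (U x) (V x)| ≤ |reactionV a b c (U x) (V x)| := by
      rw [abs_mul, abs_of_pos hx0]
      exact mul_le_of_le_one_left (abs_nonneg _) hx1.le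
    have h4 : 0 ≤ min (-V' x) 0 ^ 2 / V x := by positivity
    have h5 : |x * (min (-V' x) 0 ^ 2 / V x)| ≤ min (-V' x) 0 ^ 2 / V x := by
      rw [abs_mul, abs_of_pos hx0, abs_of_nonneg h4]
      exact mul_le_of_le_one_left h4 hx1.le
    linarith
  have habs : |flux a b c K U V U' V' x| < ε := by
    rw [hflux, abs_mul]
    rw [lt_div_iff₀ hQ0] at hV2
    nlinarith [abs_nonneg (min (-V' x) 0)]
  have := (abs_lt.1 habs).1
  linarith

theorem eventually_flux_le {ε : ℝ} (hε : 0 < ε) :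
    ∀ᶠ r in F, flux a b c K U V U' V' r ≤ ε * r ^ 2 := by
  have hs := S.s_pos
  have hlimH : ∀ f : ℝ → ℝ → ℝ, Continuous (fun p : ℝ × ℝ => f p.1 p.2) →
      ∃ C, ∀ᶠ r in F, |f (U r) (V r)| ≤ C := fun f hf =>
    ⟨|f s s| + 1, ((hf.tendsto (s, s)).comp
      (S.tendsto_end_U.prodMk_nhds S.tendsto_end_V)).abs.eventually_le_const (lt_add_one _)⟩
  obtain ⟨CU, hCU⟩ := hlimH (reactionU a b c) (by unfold reactionU; fun_prop)
  obtain ⟨CV, hCV⟩ := hlimH (reactionV a b c) (by unfold reactionV; fun_prop)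
  obtain ⟨CI, hCI⟩ := hlimH (fun p _ => p) (by fun_prop)
  obtain ⟨CJ, hCJ⟩ := hlimH (fun _ p => p) (by fun_prop)
  obtain ⟨r₀, hr₀, hbd⟩ := S.domain.exists_forall_ge ((hCU.and hCV).and ((hCI.and hCJ).and
    (S.tendsto_end_U.eventually_const_le (half_lt_self hs))))
  have hr0 := S.domain.pos hr₀
  have hK := S.one_le_K
  have hCU0 : 0 ≤ CU := (abs_nonneg _).trans (hbd r₀ hr₀ le_rfl).1.1
  have hCI0 : 0 ≤ CI := (abs_nonneg _).trans (hbd r₀ hr₀ le_rfl).2.1.1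
  have hlap : ∀ r ∈ I, r₀ ≤ r →
      |K / r ^ 2 * U r + reactionU a b c (U r) (V r)| ≤ K / r₀ ^ 2 * CI + CU := fun r hr hrr => by
    obtain ⟨⟨h1, -⟩, ⟨h2, -⟩, -⟩ := hbd r hr hrr
    refine (abs_add_le _ _).trans (add_le_add ?_ h1)
    rw [abs_mul, abs_of_pos (div_pos (by linarith) (pow_pos (S.domain.pos hr) 2))]
    gcongr
  obtain ⟨B₁, hB₁⟩ := S.domain.exists_deriv_bound hr₀ S.hasDerivAt_U S.hasDerivAt_U'
    (fun r hr hrr => (hbd r hr hrr).2.1.1)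
    (fun r hr hrr => by
      have := hlap r hr hrr
      rwa [show K / r ^ 2 * U r + reactionU a b c (U r) (V r) =
        -U' r / r + K / r ^ 2 * U r + reactionU a b c (U r) (V r) + U' r / r by ring] at this)
  obtain ⟨B₂, hB₂⟩ := S.domain.exists_deriv_bound hr₀ S.hasDerivAt_V S.hasDerivAt_V'
    (fun r hr hrr => (hbd r hr hrr).2.1.2) (C := CV)
    (fun r hr hrr => by
      have := (hbd r hr hrr).1.2
      rwa [show reactionV a b c (U r) (V r) =
        -V' r / r + reactionV a b c (U r) (V r) + V' r / r by ring] at this)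
  have hdiv : ∀ {r p B : ℝ}, r₀ ≤ r → |p| ≤ B → |-p / r| ≤ B / r₀ := fun {r p B} hrr hp => by
    have hB := (abs_nonneg p).trans hp
    rw [abs_div, abs_neg, abs_of_pos (hr0.trans_le hrr)]
    gcongr
  have hU'' : ∀ r ∈ I, r₀ ≤ r →
      |-U' r / r + K / r ^ 2 * U r + reactionU a b c (U r) (V r)| ≤
        B₁ / r₀ + (K / r₀ ^ 2 * CI + CU) := fun r hr hrr => by
    rw [add_assoc]
    exact (abs_add_le _ _).trans (add_le_add (hdiv hrr (hB₁ r hr hrr)) (hlap r hr hrr))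
  have hV'' : ∀ r ∈ I, r₀ ≤ r →
      |-V' r / r + reactionV a b c (U r) (V r)| ≤ B₂ / r₀ + CV := fun r hr hrr =>
    (abs_add_le _ _).trans (add_le_add (hdiv hrr (hB₂ r hr hrr)) (hbd r hr hrr).1.2)
  obtain ⟨B, hB1, hB2, hB3, hB4⟩ : ∃ B, B₁ ≤ B ∧ B₂ ≤ B ∧
      B₁ / r₀ + (K / r₀ ^ 2 * CI + CU) ≤ B ∧ B₂ / r₀ + CV ≤ B :=
    ⟨max (max B₁ B₂) (max (B₁ / r₀ + (K / r₀ ^ 2 * CI + CU)) (B₂ / r₀ + CV)), by simp⟩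
  have hB0 : 0 ≤ B := ((abs_nonneg _).trans (hB₁ r₀ hr₀ le_rfl)).trans hB1
  set Q := 3 * (B + B ^ 2 * (2 / s)) + B + 1 with hQ
  have hQ0 : 0 < Q := by positivity
  have hδ : 0 < ε / Q := by positivity
  filter_upwards [S.domain.eventually_neg_le_deriv hr₀ S.hasDerivAt_U S.hasDerivAt_U' S.U_le_s
      S.tendsto_end_U (fun r hr hrr => (hB₁ r hr hrr).trans hB1)
      (fun r hr hrr => (hU'' r hr hrr).trans hB3) hδ,
    S.domain.eventually_neg_le_deriv hr₀ (fun r hr => (S.hasDerivAt_V r hr).neg)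
      (fun r hr => (S.hasDerivAt_V' r hr).neg) (fun r hr => neg_le_neg (S.s_le_V r hr))
      S.tendsto_end_V.neg (fun r hr hrr => by
        rw [abs_neg]; exact (hB₂ r hr hrr).trans hB2)
      (fun r hr hrr => by rw [abs_neg]; exact (hV'' r hr hrr).trans hB4) hδ,
    S.domain.eventually_gt hr₀] with r hm hn ⟨hr, hrr⟩
  have hrp := S.domain.pos hr
  have hV := S.V_pos r hr
  have hU2 : s / 2 ≤ U r := (hbd r hr hrr.le).2.2
  have h1 := (hU'' r hr hrr.le).trans hB3
  have h2 := (hV'' r hr hrr.le).trans hB4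
  have h3 := (hB₁ r hr hrr.le).trans hB1
  have hδr : 0 < ε / Q * r := by positivity
  have hm' : -(ε / Q * r) ≤ min (U' r) 0 := le_min hm (by linarith)
  have hn' : -(ε / Q * r) ≤ min (-V' r) 0 := le_min hn (by linarith)
  have hm0 : min (U' r) 0 ≤ 0 := min_le_right _ _
  have hn0 : min (-V' r) 0 ≤ 0 := min_le_right _ _
  have hmB : -B ≤ min (U' r) 0 := le_min (abs_le.1 h3).1 (by linarith)
  rw [flux]
  generalize min (U' r) 0 = m at *
  generalize min (-V' r) 0 = n at *
  generalize -U' r / r + K / r ^ 2 * U r + reactionU a b c (U r) (V r) = W at *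
  generalize -V' r / r + reactionV a b c (U r) (V r) = Z at *
  have e1 : W * m - m ^ 3 / U r ≤ (B + B ^ 2 * (2 / s)) * (ε / Q * r) := by
    have : m ^ 2 / U r ≤ B ^ 2 * (2 / s) := by
      have h4 : m ^ 2 ≤ B ^ 2 := by nlinarith
      calc m ^ 2 / U r ≤ B ^ 2 / (s / 2) := by gcongr
        _ = B ^ 2 * (2 / s) := by field_simp
    have h5 : -W + m ^ 2 / U r ≤ B + B ^ 2 * (2 / s) := by linarith [(abs_le.1 h1).1]
    calc W * m - m ^ 3 / U r = (-W + m ^ 2 / U r) * -m := by ring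
      _ ≤ (B + B ^ 2 * (2 / s)) * -m := mul_le_mul_of_nonneg_right h5 (by linarith)
      _ ≤ (B + B ^ 2 * (2 / s)) * (ε / Q * r) :=
        mul_le_mul_of_nonneg_left (by linarith) (by positivity)
  have e2 : -Z * n + n ^ 3 / V r ≤ B * (ε / Q * r) := by
    have h4 : n ^ 3 / V r ≤ 0 := div_nonpos_of_nonpos_of_nonneg
      (by nlinarith [sq_nonneg n]) hV.le
    have h5 : -Z * n ≤ B * -n := by nlinarith [(abs_le.1 h2).2]
    have h6 : B * -n ≤ B * (ε / Q * r) := mul_le_mul_of_nonneg_left (by linarith) hB0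
    linarith
  calc 3 * (r * (W * m - m ^ 3 / U r)) + r * (-Z * n + n ^ 3 / V r)
      ≤ 3 * (r * ((B + B ^ 2 * (2 / s)) * (ε / Q * r))) + r * (B * (ε / Q * r)) := by gcongr
    _ ≤ Q * (ε / Q * r * r) := by
      rw [hQ]
      have : 0 ≤ ε / Q * r * r := by positivity
      rw [← hQ]
      linarith
    _ = ε * r ^ 2 := by field_simp

theorem flux_eq_zero : ∀ r ∈ I, flux a b c K U V U' V' r = 0 := by
  intro r hr
  refine le_antisymm ?_ (S.flux_nonneg r hr)
  have hr0 := S.domain.pos hr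
  by_contra! hpos
  have := S.domain.neBot
  obtain ⟨x, hx1, hx, hrx⟩ := ((S.eventually_flux_le
    (half_pos (div_pos hpos (pow_pos hr0 2)))).and (S.domain.eventually_gt hr)).exists
  have h1 := S.flux_div_sq_mono hr hx hrx.le
  have h2 := (div_le_iff₀ (pow_pos (S.domain.pos hx) 2)).2 hx1
  linarith [div_pos hpos (pow_pos hr0 2)]

theorem derivs_sign : ∀ r ∈ I, 0 ≤ U' r ∧ V' r ≤ 0 := by
  intro r hr
  obtain ⟨D, hD, -, h⟩ := S.exists_hasDerivWithinAt_flux hr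
  have hzero : HasDerivWithinAt (flux a b c K U V U' V') 0 (Ici r) r := by
    refine ((hasDerivAt_const r (0 : ℝ)).congr_of_eventuallyEq ?_).hasDerivWithinAt
    filter_upwards [S.domain.isOpen.eventually_mem hr] with x hx using S.flux_eq_zero x hx
  have hD0 : D = 0 := (uniqueDiffOn_Ici r r self_mem_Ici).eq_deriv _ hD hzero
  rw [hD0, mul_zero] at h
  have h1 : min (U' r) 0 = 0 := by
    nlinarith [sq_nonneg (min (U' r) 0), sq_nonneg (min (-V' r) 0)]
  have h2 : min (-V' r) 0 = 0 := by
    nlinarith [sq_nonneg (min (U' r) 0), sq_nonneg (min (-V' r) 0)]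
  exact ⟨min_eq_right_iff.1 h1, neg_nonneg.1 (min_eq_right_iff.1 h2)⟩

theorem U'_pos : ∀ r ∈ I, 0 < U' r := by
  intro r hr
  refine (S.derivs_sign r hr).1.lt_of_ne' fun h0 => ?_
  have hr0 := S.domain.pos hr
  have hev := S.domain.isOpen.eventually_mem hr
  have hmax : IsLocalMax (fun x => -U' x) r := hev.mono fun x hx => by
    have := (S.derivs_sign x hx).1
    linarith
  have hW := hmax.hasDerivAt_eq_zero (S.hasDerivAt_U' r hr).neg
  have h2 := hmax.second_deriv_nonpos (hev.mono fun x hx => (S.hasDerivAt_U' x hx).neg)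
    (S.hasDerivAt_U'' hr).neg
  rw [neg_eq_zero.1 hW, h0] at h2
  have h3 : 0 < 2 * K * U r / r ^ 3 := by
    have := S.U_pos r hr
    have := S.one_le_K
    positivity
  have h4 : U r * (c * V r - b) / 3 * V' r ≤ 0 := by
    have : 0 ≤ c * V r - b := by nlinarith [S.b_lt, S.s_le_V r hr, S.c_pos]
    have := S.U_pos r hr
    exact mul_nonpos_of_nonneg_of_nonpos (by positivity) (S.derivs_sign r hr).2
  simp only [neg_zero, zero_div, mul_zero] at h2
  linarith

theorem V'_neg : ∀ r ∈ I, V' r < 0 := by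
  intro r hr
  refine (S.derivs_sign r hr).2.lt_of_ne fun h0 => ?_
  have hev := S.domain.isOpen.eventually_mem hr
  have hmax : IsLocalMax V' r := hev.mono fun x hx => by
    rw [h0]
    exact (S.derivs_sign x hx).2
  have hZ := hmax.hasDerivAt_eq_zero (S.hasDerivAt_V' r hr)
  have h2 := hmax.second_deriv_nonpos (hev.mono fun x hx => S.hasDerivAt_V' x hx)
    (S.hasDerivAt_V'' hr)
  rw [hZ, h0] at h2
  have h4 : 0 < U r * (c * V r - b) * U' r := by
    have : 0 < c * V r - b := by nlinarith [S.b_lt, S.s_le_V r hr, S.c_pos]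
    exact mul_pos (mul_pos (S.U_pos r hr) this) (S.U'_pos r hr)
  simp only [neg_zero, zero_div, mul_zero] at h2
  linarith

end RescaledProfile

theorem isRadialInterval_Iset {R : ℝ≥0∞} (hR : 0 < R) :
    IsRadialInterval (Iset R) (endFilter R) := by
  by_cases h : R = ⊤
  · left
    subst h
    exact ⟨by ext r; simp [Iset], if_pos rfl⟩
  · refine Or.inr ⟨R.toReal, ENNReal.toReal_pos hR.ne' h, ?_, if_neg h⟩
    ext r
    exact and_congr_right fun hr => ENNReal.ofReal_lt_iff_lt_toReal hr.le h

theorem ProfileSolution.rescaled {a2 b2 c2 : ℝ} (hb : 0 < b2) (hc : 0 < c2)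
    (hsub : b2 ^ 2 < 3 * a2 * c2) {k : ℤ} (hk : k ≠ 0) {R : ℝ≥0∞} (hR : 0 < R)
    {u v : ℝ → ℝ} (hsol : ProfileSolution a2 b2 c2 k R u v)
    (hu : ∀ r ∈ Iset R, 0 < u r) (hv : ∀ r ∈ Iset R, v r < 0) :
    RescaledProfile a2 b2 c2 ((k : ℝ) ^ 2) (sPlus a2 b2 c2) (Iset R) (endFilter R)
      (fun r => √2 * u r) (fun r => -√6 * v r)
      (fun r => √2 * deriv u r) (fun r => -√6 * deriv v r) := by
  have hdom := isRadialInterval_Iset hR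
  have h2 : √2 ^ 2 = 2 := Real.sq_sqrt (by norm_num)
  have h6 : √6 ^ 2 = 6 := Real.sq_sqrt (by norm_num)
  have h23 : √2 ^ 3 = √2 * 2 := by rw [pow_succ, h2, mul_comm]
  have h63 : √6 ^ 3 = √6 * 6 := by rw [pow_succ, h6, mul_comm]
  have h20 : 0 < √2 := by positivity
  have h60 : 0 < √6 := by positivity
  have hdisc : √(b2 ^ 2 + 24 * a2 * c2) ^ 2 = b2 ^ 2 + 24 * a2 * c2 :=
    Real.sq_sqrt (by nlinarith [sq_nonneg b2])
  have hlt : 3 * b2 < √(b2 ^ 2 + 24 * a2 * c2) := Real.lt_sqrt_of_sq_lt (by nlinarith)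
  have hC2 : ∀ f : ℝ → ℝ, ContDiffOn ℝ 2 f (Iset R) → ∀ r ∈ Iset R,
      HasDerivAt f (deriv f r) r ∧ HasDerivAt (deriv f) (deriv (deriv f) r) r := by
    intro f hf r hr
    refine ⟨((hf.differentiableOn (by norm_num)).differentiableAt
      (hdom.isOpen.mem_nhds hr)).hasDerivAt, ?_⟩
    have h : ContDiffOn ℝ 1 (deriv f) (Iset R) :=
      hf.deriv_of_isOpen hdom.isOpen (by norm_num)
    exact ((h.differentiableOn (by norm_num)).differentiableAt
      (hdom.isOpen.mem_nhds hr)).hasDerivAt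
  refine ⟨hb, hc, ?_, ?_, ?_, ?_, hdom, fun r hr => mul_pos h20 (hu r hr),
    fun r hr => mul_pos_of_neg_of_neg (neg_neg_of_pos h60) (hv r hr),
    fun r hr => (hC2 u hsol.smooth_u r hr).1.const_mul _,
    fun r hr => (hC2 v hsol.smooth_v r hr).1.const_mul _,
    fun r hr => ?_, fun r hr => ?_, ?_, ?_, ?_, ?_⟩
  · exact_mod_cast one_le_sq_iff_one_le_abs k |>.2 (Int.one_le_abs hk)
  · rw [sPlus]
    positivity
  · rw [sPlus]
    generalize √(b2 ^ 2 + 24 * a2 * c2) = D at hdisc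
    field_simp
    linear_combination 2 * hdisc
  · rw [sPlus]
    generalize √(b2 ^ 2 + 24 * a2 * c2) = D at hlt
    field_simp
    linarith
  · refine ((hC2 u hsol.smooth_u r hr).2.const_mul √2).congr_deriv ?_
    have hode := hsol.ode_u r hr
    rw [hfun] at hode
    rw [eq_sub_of_add_eq (eq_add_of_sub_eq hode), reactionU]
    have h : b2 / √6 = b2 * √6 / 6 := by field_simp; rw [h6]
    rw [mul_div_assoc, h]
    ring_nf
    simp only [h23, h6]
    ring
  · refine ((hC2 v hsol.smooth_v r hr).2.const_mul (-√6)).congr_deriv ?_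
    have hode := hsol.ode_v r hr
    rw [gfun] at hode
    rw [eq_sub_of_add_eq hode, reactionV]
    have h : b2 / √6 = b2 * √6 / 6 := by field_simp; rw [h6]
    rw [h]
    ring_nf
    simp only [h63, h6, h2]
    ring
  · simpa using hsol.bc0_u.const_mul √2
  · simpa using hsol.bc0_v.const_mul (-√6)
  · have := hsol.bcR_u.const_mul √2
    rwa [mul_div_cancel₀ _ h20.ne'] at this
  · have := hsol.bcR_v.const_mul (-√6)
    rwa [neg_mul_neg, mul_div_cancel₀ _ h60.ne'] at this

/-- **Monotonicity, subcritical case `b⁴ < 3a²c²`**: for any profile solution with `u > 0`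
and `v < 0` on `(0,R)`, both `u' > 0` and `v' > 0` on `(0,R)`. -/
theorem stmt0 (a2 b2 c2 : ℝ) (ha : 0 ≤ a2) (hb : 0 < b2) (hc : 0 < c2)
    (hsub : b2 ^ 2 < 3 * a2 * c2) (k : ℤ) (hk : k ≠ 0) (R : ℝ≥0∞) (hR : 0 < R)
    (u v : ℝ → ℝ) (hsol : ProfileSolution a2 b2 c2 k R u v)
    (hu : ∀ r ∈ Iset R, 0 < u r) (hv : ∀ r ∈ Iset R, v r < 0) :
    ∀ r ∈ Iset R, 0 < deriv u r ∧ 0 < deriv v r := by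
  have S := hsol.rescaled hb hc hsub hk hR hu hv
  intro r hr
  exact ⟨pos_of_mul_pos_right (S.U'_pos r hr) (Real.sqrt_nonneg 2),
    by simpa using S.V'_neg r hr⟩

end
end

section
/- Monotonicity of profile components, critical case: Assume a² ≥ 0, b², c² > 0 with b⁴ = 3a²c², let k ∈ ℤ \ {0} and R ∈ (0,∞]. Let (u,v) be any profile solution on (0,R) such that u(r) > 0 and v(r) < 0 for all r ∈ (0,R). Then u'(r) > 0 for all r ∈ (0,R), and v is constant with v(r) = −s₊/√6 for all r ∈ (0,R). -/
open Real MeasureTheory Filter Set Topology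
open scoped ENNReal

noncomputable section

lemma isOpen_Iset (R : ℝ≥0∞) : IsOpen (Iset R) :=
  (isOpen_lt continuous_const continuous_id).inter
    (isOpen_lt ENNReal.continuous_ofReal continuous_const)

lemma ordConnected_Iset (R : ℝ≥0∞) : (Iset R).OrdConnected :=
  ⟨fun _ hx _ hy _ hz =>
    ⟨hx.1.trans_le hz.1, (ENNReal.ofReal_le_ofReal hz.2).trans_lt hy.2⟩⟩

lemma neBot_endFilter (R : ℝ≥0∞) : (endFilter R).NeBot := by
  unfold endFilter
  split_ifs <;> infer_instance

lemma eventually_endFilter {R : ℝ≥0∞} {r : ℝ} (hr : r ∈ Iset R) :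
    ∀ᶠ s in endFilter R, s ∈ Iset R ∧ r < s := by
  unfold endFilter
  split_ifs with h
  · filter_upwards [eventually_gt_atTop r] with s hs
    exact ⟨⟨hr.1.trans hs, by simp [h]⟩, hs⟩
  · have hrR : r < R.toReal := (ENNReal.ofReal_lt_iff_lt_toReal hr.1.le h).1 hr.2
    filter_upwards [self_mem_nhdsWithin, mem_nhdsWithin_of_mem_nhds (Ioi_mem_nhds hrR)]
      with s hs hs'
    exact ⟨⟨hr.1.trans hs', (ENNReal.ofReal_lt_iff_lt_toReal (hr.1.trans hs').le h).2 hs⟩, hs'⟩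

lemma eventually_nhdsGT_zero_mem_Iset {R : ℝ≥0∞} {r : ℝ} (hr : r ∈ Iset R) :
    ∀ᶠ s in 𝓝[>] (0 : ℝ), s ∈ Iset R ∧ s < r := by
  filter_upwards [Ioo_mem_nhdsGT hr.1] with s hs
  exact ⟨⟨hs.1, (ENNReal.ofReal_le_ofReal hs.2.le).trans_lt hr.2⟩, hs.2⟩

lemma ContDiffOn.hasDerivAt_two {f : ℝ → ℝ} {s : Set ℝ} (hf : ContDiffOn ℝ 2 f s)
    (hs : IsOpen s) {x : ℝ} (hx : x ∈ s) :
    HasDerivAt f (deriv f x) x ∧ HasDerivAt (deriv f) (deriv (deriv f) x) x := by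
  have h1 := hf.differentiableOn (by norm_num)
  have h2 : ContDiffOn ℝ 1 (deriv f) s := hf.deriv_of_isOpen hs (by norm_num)
  exact ⟨(h1.differentiableAt (hs.mem_nhds hx)).hasDerivAt,
    ((h2.differentiableOn (by norm_num)).differentiableAt (hs.mem_nhds hx)).hasDerivAt⟩

lemma IsLocalMax.deriv_deriv_nonpos {f : ℝ → ℝ} {x : ℝ} (h : IsLocalMax f x)
    (hc : ContinuousAt f x) : deriv (deriv f) x ≤ 0 := by
  by_contra! hpos
  have hmin := isLocalMin_of_deriv_deriv_pos hpos h.deriv_eq_zero hc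
  have hconst : f =ᶠ[𝓝 x] fun _ => f x := by
    filter_upwards [h, hmin] with y h1 h2 using le_antisymm h1 h2
  have h0 : deriv (deriv f) x = 0 := by
    rw [hconst.deriv.deriv_eq]
    simp
  exact hpos.ne' h0

lemma IsLocalMin.deriv_deriv_nonneg {f : ℝ → ℝ} {x : ℝ} (h : IsLocalMin f x)
    (hc : ContinuousAt f x) : 0 ≤ deriv (deriv f) x := by
  have h1 : IsLocalMax (fun y => -f y) x := h.neg
  have h2 := h1.deriv_deriv_nonpos hc.neg
  have h3 : deriv (fun y => -f y) = fun y => -deriv f y := by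
    ext y; exact deriv.fun_neg
  rw [h3, deriv.fun_neg] at h2
  linarith

lemma sPlus_of_critical {a2 b2 c2 : ℝ} (hb : 0 < b2) (hc : 0 < c2)
    (hcrit : b2 ^ 2 = 3 * a2 * c2) : sPlus a2 b2 c2 = b2 / c2 := by
  have h : b2 ^ 2 + 24 * a2 * c2 = (3 * b2) ^ 2 := by linarith
  rw [sPlus, h, Real.sqrt_sq (by positivity)]
  field_simp
  ring

lemma gfun_of_critical {a2 b2 c2 : ℝ} (hc : 0 < c2) (hcrit : b2 ^ 2 = 3 * a2 * c2) (p q : ℝ) :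
    gfun a2 b2 c2 p q = c2 * (p ^ 2 + q * (q - 2 * (b2 / c2 / √6))) * (q + b2 / c2 / √6) := by
  obtain ⟨t, ht⟩ : ∃ t, t = (√6)⁻¹ := ⟨_, rfl⟩
  obtain ⟨s, hs⟩ : ∃ s, s = b2 / c2 := ⟨_, rfl⟩
  have ht2 : t ^ 2 = 1 / 6 := by rw [ht, inv_pow, Real.sq_sqrt (by norm_num)]; norm_num
  have hb : b2 = s * c2 := by rw [hs]; field_simp
  have ha : a2 = c2 * s ^ 2 / 3 := by
    rw [hb] at hcrit
    have : c2 * (3 * a2 - c2 * s ^ 2) = 0 := by linarith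
    have := (mul_eq_zero.1 this).resolve_left hc.ne'
    linarith
  simp only [gfun, ← hs, div_eq_mul_inv _ (√6), ← ht]
  rw [hb, ha]
  linear_combination (2 * c2 * s ^ 2 * q) * ht2

lemma hfun_of_critical {a2 b2 c2 : ℝ} (hc : 0 < c2) (hcrit : b2 ^ 2 = 3 * a2 * c2) (p : ℝ) :
    hfun a2 b2 c2 p (-(b2 / c2 / √6)) = c2 * p * (p ^ 2 - (b2 / c2 / √2) ^ 2) := by
  obtain ⟨t, ht⟩ : ∃ t, t = (√6)⁻¹ := ⟨_, rfl⟩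
  obtain ⟨s, hs⟩ : ∃ s, s = b2 / c2 := ⟨_, rfl⟩
  have ht2 : t ^ 2 = 1 / 6 := by rw [ht, inv_pow, Real.sq_sqrt (by norm_num)]; norm_num
  have hb : b2 = s * c2 := by rw [hs]; field_simp
  have ha : a2 = c2 * s ^ 2 / 3 := by
    rw [hb] at hcrit
    have : c2 * (3 * a2 - c2 * s ^ 2) = 0 := by linarith
    have := (mul_eq_zero.1 this).resolve_left hc.ne'
    linarith
  rw [div_pow _ (√2), Real.sq_sqrt (by norm_num)]
  simp only [hfun, ← hs, div_eq_mul_inv _ (√6), ← ht]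
  rw [hb, ha]
  linear_combination (-c2 * s ^ 2 * p) * ht2

/-- A solution of `w'' + w'/r = C w` on `(0,R)` with `C ≥ 0`, `w'(0) = 0` and `w(R) = 0`
vanishes identically. -/
lemma eq_zero_of_radial_ode {R : ℝ≥0∞} {w C : ℝ → ℝ} (hw : ContDiffOn ℝ 2 w (Iset R))
    (hC : ∀ r ∈ Iset R, 0 ≤ C r)
    (hode : ∀ r ∈ Iset R, deriv (deriv w) r + deriv w r / r = C r * w r)
    (h0 : Tendsto (deriv w) (𝓝[>] 0) (𝓝 0)) (hend : Tendsto w (endFilter R) (𝓝 0)) :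
    ∀ r ∈ Iset R, w r = 0 := by
  have hd := fun r hr => hw.hasDerivAt_two (isOpen_Iset R) (x := r) hr
  have hconv : Convex ℝ (Iset R) := (ordConnected_Iset R).convex
  have hint : interior (Iset R) = Iset R := (isOpen_Iset R).interior_eq
  have hP : ∀ r ∈ Iset R, HasDerivAt (fun r => r * deriv w r * w r)
      (r * deriv w r ^ 2 + r * C r * w r ^ 2) r := by
    intro r hr
    obtain ⟨h1, h2⟩ := hd r hr
    refine (((hasDerivAt_id' r).fun_mul h2).fun_mul h1).congr_deriv ?_
    have h3 := hode r hr
    have hr0 : r ≠ 0 := hr.1.ne'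
    field_simp at h3
    linear_combination w r * h3
  have hPmono : MonotoneOn (fun r => r * deriv w r * w r) (Iset R) := by
    refine monotoneOn_of_deriv_nonneg hconv
      (fun r hr => (hP r hr).continuousAt.continuousWithinAt)
      (fun r hr => (hP r (hint ▸ hr)).differentiableAt.differentiableWithinAt) fun r hr => ?_
    rw [hint] at hr
    rw [(hP r hr).deriv]
    have := hr.1
    have := hC r hr
    positivity
  intro r hr
  have hPlim : Tendsto (fun r => r * deriv w r * w r) (𝓝[>] 0) (𝓝 0) := by
    have hsmall : ∀ᶠ x in 𝓝[>] (0 : ℝ), ‖deriv w x‖ < 1 := by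
      have := h0.norm
      rw [norm_zero] at this
      exact this.eventually_lt_const one_pos
    obtain ⟨δ, hδ, hδ'⟩ := mem_nhdsGT_iff_exists_Ioo_subset.1
      (hsmall.and (eventually_nhdsGT_zero_mem_Iset hr))
    have hδ0 : (0 : ℝ) < δ := hδ
    have hbdd : ∀ x ∈ Ioo 0 δ, ‖w x‖ ≤ ‖w (δ / 2)‖ + δ := by
      intro x hx
      have hm : δ / 2 ∈ Ioo 0 δ := ⟨by positivity, by linarith⟩
      have h1 := (convex_Ioo (0 : ℝ) δ).norm_image_sub_le_of_norm_hasDerivWithin_le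
        (f := w) (f' := deriv w) (C := 1)
        (fun y hy => (hd y (hδ' hy).2.1).1.hasDerivWithinAt)
        (fun y hy => (hδ' hy).1.le) hm hx
      have h2 : ‖x - δ / 2‖ ≤ δ := by
        rw [Real.norm_eq_abs, abs_le]
        constructor <;> linarith [hx.1, hx.2]
      have h3 := norm_le_norm_add_norm_sub' (w x) (w (δ / 2))
      linarith
    have h1 : Tendsto (fun r => r * deriv w r) (𝓝[>] 0) (𝓝 0) := by
      simpa using (tendsto_id.mono_left (nhdsWithin_le_nhds (a := (0 : ℝ)))).mul h0
    refine h1.zero_mul_isBoundedUnder_le (isBoundedUnder_of_eventually_le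
      (a := ‖w (δ / 2)‖ + δ) ?_)
    filter_upwards [Ioo_mem_nhdsGT hδ0] with x hx using hbdd x hx
  have hPnonneg : ∀ x ∈ Iset R, 0 ≤ x * deriv w x * w x := fun x hx => by
    refine le_of_tendsto hPlim ?_
    filter_upwards [eventually_nhdsGT_zero_mem_Iset hx] with y hy
    exact hPmono hy.1 hx hy.2.le
  have hQ : ∀ x ∈ Iset R, HasDerivAt (fun x => w x ^ 2) (2 * w x * deriv w x) x := by
    intro x hx
    simpa using (hd x hx).1.fun_pow 2
  have hQmono : MonotoneOn (fun x => w x ^ 2) (Iset R) := by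
    refine monotoneOn_of_deriv_nonneg hconv
      (fun r hr => (hQ r hr).continuousAt.continuousWithinAt)
      (fun r hr => (hQ r (hint ▸ hr)).differentiableAt.differentiableWithinAt) fun x hx => ?_
    rw [hint] at hx
    rw [(hQ x hx).deriv]
    have h1 : 0 ≤ x * (deriv w x * w x) := by linarith [hPnonneg x hx]
    linarith [nonneg_of_mul_nonneg_right h1 hx.1]
  have := neBot_endFilter R
  have hQlim : Tendsto (fun x => w x ^ 2) (endFilter R) (𝓝 0) := by simpa using hend.pow 2
  have h1 : w r ^ 2 ≤ 0 := by
    refine ge_of_tendsto hQlim ?_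
    filter_upwards [eventually_endFilter hr] with y hy
    exact hQmono hr hy.1 hy.2.le
  exact pow_eq_zero_iff two_ne_zero |>.1 (le_antisymm h1 (sq_nonneg _))

/-- A positive solution of `u'' + u'/r = u (K/r² - c(m² - u²))` on `(0,R)`, with `K, c > 0`,
`u(0) = 0` and `u(R) = m ≥ 0`, is strictly increasing. -/
lemma deriv_pos_of_radial_ode {R : ℝ≥0∞} {u : ℝ → ℝ} {K c m : ℝ} (hK : 0 < K) (hc : 0 < c)
    (hm : 0 ≤ m) (hu : ContDiffOn ℝ 2 u (Iset R)) (hpos : ∀ r ∈ Iset R, 0 < u r)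
    (hode : ∀ r ∈ Iset R,
      deriv (deriv u) r + deriv u r / r = u r * (K / r ^ 2 - c * (m ^ 2 - u r ^ 2)))
    (h0 : Tendsto u (𝓝[>] 0) (𝓝 0)) (hend : Tendsto u (endFilter R) (𝓝 m)) :
    ∀ r ∈ Iset R, 0 < deriv u r := by
  have hopen := isOpen_Iset R
  have hoc := ordConnected_Iset R
  have hd := fun r hr => hu.hasDerivAt_two hopen (x := r) hr
  have hcont : ContinuousOn u (Iset R) := hu.continuousOn
  have hmono : MonotoneOn u (Iset R) := by
    intro x hx y hy hxy
    by_contra! hlt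
    obtain ⟨e, hue, he, hex⟩ :=
      ((h0.eventually_lt_const (hpos x hx)).and (eventually_nhdsGT_zero_mem_Iset hx)).exists
    obtain ⟨p, hp, hpmax⟩ := isCompact_Icc.exists_isMaxOn
      (nonempty_Icc.2 (hex.le.trans hxy)) (hcont.mono (hoc.out he hy))
    have hpR : p ∈ Iset R := hoc.out he hy hp
    have hxp : u x ≤ u p := hpmax ⟨hex.le, hxy⟩
    have hep : e < p := lt_of_le_of_ne hp.1 (by rintro rfl; linarith)
    have hpy : p < y := lt_of_le_of_ne hp.2 (by rintro rfl; linarith)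
    have hpmax' : IsLocalMax u p := hpmax.isLocalMax (Icc_mem_nhds hep hpy)
    have hp2 := hpmax'.deriv_deriv_nonpos (hd p hpR).1.continuousAt
    have hpode := hode p hpR
    rw [hpmax'.deriv_eq_zero, zero_div, add_zero] at hpode
    have hpF : K / p ^ 2 - c * (m ^ 2 - u p ^ 2) ≤ 0 := by
      rw [hpode] at hp2
      exact nonpos_of_mul_nonpos_right hp2 (hpos p hpR)
    have hKp : 0 < K / p ^ 2 := by have := hpR.1; positivity
    have hupm : u p < m := by
      refine lt_of_pow_lt_pow_left₀ 2 hm ?_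
      have : 0 < c * (m ^ 2 - u p ^ 2) := by linarith
      linarith [pos_of_mul_pos_right this hc.le]
    have := neBot_endFilter R
    obtain ⟨z, huz, hz, hyz⟩ :=
      ((hend.eventually_const_lt (show u y < m by linarith)).and (eventually_endFilter hy)).exists
    obtain ⟨q, hq, hqmin⟩ := isCompact_Icc.exists_isMinOn
      (nonempty_Icc.2 (hpy.trans hyz).le) (hcont.mono (hoc.out hpR hz))
    have hqR : q ∈ Iset R := hoc.out hpR hz hq
    have hqy : u q ≤ u y := hqmin ⟨hpy.le, hyz.le⟩
    have hpq : p < q := lt_of_le_of_ne hq.1 (by rintro rfl; linarith)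
    have hqz : q < z := lt_of_le_of_ne hq.2 (by rintro rfl; linarith)
    have hqmin' : IsLocalMin u q := hqmin.isLocalMin (Icc_mem_nhds hpq hqz)
    have hq2 := hqmin'.deriv_deriv_nonneg (hd q hqR).1.continuousAt
    have hqode := hode q hqR
    rw [hqmin'.deriv_eq_zero, zero_div, add_zero] at hqode
    have hqF : 0 ≤ K / q ^ 2 - c * (m ^ 2 - u q ^ 2) := by
      rw [hqode] at hq2
      exact nonneg_of_mul_nonneg_right hq2 (hpos q hqR)
    have h1 : K / q ^ 2 < K / p ^ 2 := by
      have := hpR.1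
      gcongr
    have h2 : u q ^ 2 < u p ^ 2 := by
      have := hpos q hqR
      have : u q < u p := by linarith
      gcongr
    have h3 := mul_lt_mul_of_pos_left h2 hc
    linarith
  have hnonneg : ∀ r ∈ Iset R, 0 ≤ deriv u r := by
    intro r hr
    rw [← derivWithin_of_isOpen hopen hr]
    exact hmono.derivWithin_nonneg
  intro r hr
  refine lt_of_le_of_ne (hnonneg r hr) fun hzero => ?_
  have hr0 : 0 < r := hr.1
  let F : ℝ → ℝ := fun x => K / x ^ 2 - c * (m ^ 2 - u x ^ 2)
  have hG : ∀ x ∈ Iset R, HasDerivAt (fun x => x * deriv u x) (x * u x * F x) x := by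
    intro x hx
    refine ((hasDerivAt_id' x).fun_mul (hd x hx).2).congr_deriv ?_
    have h1 : x * (deriv (deriv u) x + deriv u x / x) = x * (u x * F x) := by rw [hode x hx]
    rw [mul_add, mul_div_cancel₀ _ hx.1.ne'] at h1
    linarith
  have hGmin : IsLocalMin (fun x => x * deriv u x) r := by
    filter_upwards [hopen.mem_nhds hr] with x hx
    rw [← hzero, mul_zero]
    exact mul_nonneg hx.1.le (hnonneg x hx)
  have hFr : F r = 0 := by
    have h1 := hGmin.hasDerivAt_eq_zero (hG r hr)
    exact (mul_eq_zero.1 h1).resolve_left (mul_pos hr0 (hpos r hr)).ne'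
  have hF : HasDerivAt F (-(2 * K / r ^ 3)) r := by
    have h1 : HasDerivAt (fun x : ℝ => K / x ^ 2) (-(2 * K / r ^ 3)) r := by
      refine ((hasDerivAt_const r K).fun_div (hasDerivAt_pow 2 r) (by positivity)).congr_deriv ?_
      field_simp
      norm_num
      ring
    have h2 := (((hd r hr).1.fun_pow 2).const_sub (m ^ 2)).const_mul c
    rw [← hzero] at h2
    exact (h1.fun_sub h2).congr_deriv (by simp)
  have hFneg : ∀ᶠ x in 𝓝[>] r, F x < 0 := by
    have hneg : -(2 * K / r ^ 3) < 0 := by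
      have : 0 < 2 * K / r ^ 3 := by positivity
      linarith
    have h1 := (hasDerivAt_iff_tendsto_slope.1 hF).eventually_lt_const hneg
    have h2 := h1.filter_mono (nhdsWithin_mono r (fun x (hx : r < x) => hx.ne'))
    filter_upwards [h2, self_mem_nhdsWithin] with x hx hrx
    rw [slope_def_field, hFr, sub_zero] at hx
    have hrx' : 0 < x - r := sub_pos.2 hrx
    exact (div_neg_iff.1 hx).elim (fun h => absurd h.2 hrx'.not_gt) (fun h => h.1)
  obtain ⟨δ, hδ, hδ'⟩ := mem_nhdsGT_iff_exists_Ioo_subset.1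
    (hFneg.and (mem_nhdsWithin_of_mem_nhds (hopen.mem_nhds hr)))
  have hδr : r < δ := hδ
  obtain ⟨y, hry, hyδ⟩ := exists_between hδr
  have hyR : y ∈ Iset R := (hδ' ⟨hry, hyδ⟩).2
  have hanti : StrictAntiOn (fun x => x * deriv u x) (Icc r y) := by
    refine strictAntiOn_of_deriv_neg (convex_Icc r y)
      (fun x hx => (hG x (hoc.out hr hyR hx)).continuousAt.continuousWithinAt) fun x hx => ?_
    rw [interior_Icc] at hx
    obtain ⟨hFx, hxR⟩ := hδ' ⟨hx.1, hx.2.trans hyδ⟩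
    rw [(hG x hxR).deriv]
    exact mul_neg_of_pos_of_neg (mul_pos hxR.1 (hpos x hxR)) hFx
  have h1 := hanti (left_mem_Icc.2 hry.le) (right_mem_Icc.2 hry.le) hry
  simp only [← hzero, mul_zero] at h1
  exact h1.not_ge (mul_nonneg hyR.1.le (hnonneg y hyR))

/-- **Monotonicity, critical case `b⁴ = 3a²c²`**: for any profile solution with `u > 0`
and `v < 0` on `(0,R)`, `u' > 0` on `(0,R)` and `v` is constant equal to `−s₊/√6`. -/
theorem stmt1 (a2 b2 c2 : ℝ) (ha : 0 ≤ a2) (hb : 0 < b2) (hc : 0 < c2)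
    (hcrit : b2 ^ 2 = 3 * a2 * c2) (k : ℤ) (hk : k ≠ 0) (R : ℝ≥0∞) (hR : 0 < R)
    (u v : ℝ → ℝ) (hsol : ProfileSolution a2 b2 c2 k R u v)
    (hu : ∀ r ∈ Iset R, 0 < u r) (hv : ∀ r ∈ Iset R, v r < 0) :
    (∀ r ∈ Iset R, 0 < deriv u r) ∧
      (∀ r ∈ Iset R, v r = -(sPlus a2 b2 c2 / Real.sqrt 6)) := by
  have hs := sPlus_of_critical hb hc hcrit
  have hbcu := hsol.bcR_u
  have hbcv := hsol.bcR_v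
  rw [hs] at hbcu hbcv ⊢
  have hq0 : 0 < b2 / c2 / √6 := by positivity
  have hw : ∀ r ∈ Iset R, v r + b2 / c2 / √6 = 0 := by
    have hdw : deriv (fun r => v r + b2 / c2 / √6) = deriv v := by
      ext r; exact deriv_add_const _
    refine eq_zero_of_radial_ode (R := R)
      (C := fun r => c2 * (u r ^ 2 + v r * (v r - 2 * (b2 / c2 / √6))))
      (hsol.smooth_v.add contDiffOn_const) (fun r hr => ?_) (fun r hr => ?_) ?_ ?_
    · have h1 := hv r hr
      have h2 : 0 < v r * (v r - 2 * (b2 / c2 / √6)) := mul_pos_of_neg_of_neg h1 (by linarith)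
      positivity
    · rw [hdw, hsol.ode_v r hr, gfun_of_critical hc hcrit]
    · rw [hdw]
      exact hsol.bc0_v
    · simpa using hbcv.add_const (b2 / c2 / √6)
  have hv' : ∀ r ∈ Iset R, v r = -(b2 / c2 / √6) := fun r hr =>
    eq_neg_of_add_eq_zero_left (hw r hr)
  refine ⟨?_, hv'⟩
  have hk2 : (0 : ℝ) < (k : ℝ) ^ 2 := by positivity
  refine deriv_pos_of_radial_ode (m := b2 / c2 / √2) hk2 hc (by positivity) hsol.smooth_u hu
    (fun r hr => ?_) hsol.bc0_u hbcu
  have h1 := hsol.ode_u r hr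
  rw [hv' r hr, hfun_of_critical hc hcrit] at h1
  linear_combination h1

end
end
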